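/- arXiv:2407.18122 — 5 statements merged into one kernel-verified Lean document; each statement's English description precedes it below -/
import Mathlib

section
/- For positive integers n and k, there exist a positive integer Δ and a family F : Fin Δ → (ZMod 2^k → ZMod 2) with the perfect-factor window property for span n if and only if k ≤ n < 2^k; moreover, any such family necessarily has Δ = 2^{n−k}. -/
/-- A family `F` of `Δ` binary cyclic sequences of length `2^k` has the perfect-factor
window property for span `n`: every binary `n`-tuple appears exactly once as a window
of length `n` in exactly one of the sequences. -/
def IsPF (n k Δ : ℕ) (F : Fin Δ → (ZMod (2 ^ k) → ZMod 2)) : Prop :=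
  ∀ x : Fin n → ZMod 2,
    ∃! p : Fin Δ × ZMod (2 ^ k),
      ∀ i : Fin n, F p.1 (p.2 + (i : ℕ)) = x i

namespace PFact

open Function Equiv

/-- Summing over a period equals summing over the cycle. -/
theorem sum_cycle {A M : Type} [Fintype A] [DecidableEq A] [AddCommMonoid M] (σ : Perm A) (a : A)
    (h : A → M) [DecidablePred fun z => σ.SameCycle a z] :
    ∑ i ∈ Finset.range (minimalPeriod σ a), h (σ^[i] a)
      = ∑ z ∈ Finset.univ.filter (fun z => σ.SameCycle a z), h z := by
  have hpos : 0 < minimalPeriod σ a := by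
    apply minimalPeriod_pos_of_mem_periodicPts
    exact ⟨orderOf σ, orderOf_pos σ, by
      rw [IsPeriodicPt, IsFixedPt, Perm.iterate_eq_pow, pow_orderOf_eq_one]; rfl⟩
  refine Finset.sum_bij (fun i _ => σ^[i] a) ?_ ?_ ?_ ?_
  · intro i _
    simp only [Finset.mem_filter, Finset.mem_univ, true_and]
    exact ⟨i, by rw [zpow_natCast, Perm.iterate_eq_pow]⟩
  · intro i hi j hj hij
    exact (iterate_injOn_Iio_minimalPeriod (f := σ) (x := a)) (by simpa using hi) (by simpa using hj) hij
  · intro z hz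
    simp only [Finset.mem_filter, Finset.mem_univ, true_and] at hz
    obtain ⟨i, -, hi⟩ := hz.exists_pow_eq'
    refine ⟨i % minimalPeriod σ a, by simpa using Nat.mod_lt _ hpos, ?_⟩
    rw [iterate_mod_minimalPeriod_eq, Perm.iterate_eq_pow, hi]
  · intros; rfl

/-- Composing with a transposition of points in different cycles joins the cycles. -/
theorem swap_join {A : Type} [Fintype A] [DecidableEq A] (σ : Perm A) (x y : A)
    (hxy : ¬ σ.SameCycle x y) :
    (σ * swap x y).SameCycle x y ∧
      ∀ a b, σ.SameCycle a b → (σ * swap x y).SameCycle a b := by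
  set τ := σ * swap x y with hτ
  have hne : x ≠ y := by rintro rfl; exact hxy (Perm.SameCycle.refl _ _)
  have hpos : 0 < minimalPeriod σ x := by
    apply minimalPeriod_pos_of_mem_periodicPts
    exact ⟨orderOf σ, orderOf_pos σ, by
      rw [IsPeriodicPt, IsFixedPt, Perm.iterate_eq_pow, pow_orderOf_eq_one]; rfl⟩
  have key : ∀ j, j < minimalPeriod σ x → τ^[j+1] y = σ^[j+1] x := by
    intro j
    induction j with
    | zero => intro _; simp [hτ]
    | succ j ih =>
      intro hj
      rw [iterate_succ_apply', ih (by omega), iterate_succ_apply' (f := σ) (n := j+1)]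
      have h1 : σ^[j+1] x ≠ x := by
        intro h
        exact not_isPeriodicPt_of_pos_of_lt_minimalPeriod (by omega) hj h
      have h2 : σ^[j+1] x ≠ y := by
        intro h
        exact hxy ⟨(j+1 : ℕ), by rw [zpow_natCast, ← Perm.iterate_eq_pow, h]⟩
      rw [hτ, Perm.mul_apply, swap_apply_of_ne_of_ne h1 h2]
  have h0 : τ.SameCycle x y := by
    refine Perm.SameCycle.symm ⟨(minimalPeriod σ x : ℕ), ?_⟩
    obtain ⟨p, hp⟩ := Nat.exists_eq_succ_of_ne_zero hpos.ne'
    have := key p (by omega)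
    rw [zpow_natCast, ← Perm.iterate_eq_pow, hp]
    rw [Nat.succ_eq_add_one, this, ← Nat.succ_eq_add_one, ← hp]
    exact iterate_minimalPeriod
  refine ⟨h0, ?_⟩
  have step : ∀ z, τ.SameCycle z (σ z) := by
    intro z
    by_cases hzx : z = x
    · subst hzx
      have : σ z = τ y := by simp [hτ]
      rw [this]
      exact Perm.sameCycle_apply_right.2 h0
    · by_cases hzy : z = y
      · subst hzy
        have : σ z = τ x := by simp [hτ]
        rw [this]
        exact Perm.sameCycle_apply_right.2 h0.symm
      · have : σ z = τ z := by rw [hτ, Perm.mul_apply, swap_apply_of_ne_of_ne hzx hzy]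
        rw [this]
        exact Perm.sameCycle_apply_right.2 (Perm.SameCycle.refl _ _)
  intro a b hab
  obtain ⟨i, -, hi⟩ := hab.exists_pow_eq'
  rw [← hi]
  clear hi
  induction i with
  | zero => exact Perm.SameCycle.refl _ _
  | succ i ih =>
    rw [pow_succ', Perm.mul_apply]
    exact ih.trans (step _)

theorem inv_of_sameCycle {A T : Type} [Finite A] (σ : Perm A) (f : A → T)
    (hf : ∀ z, f (σ z) = f z) {a b : A} (h : σ.SameCycle a b) : f a = f b := by
  obtain ⟨i, -, hi⟩ := h.exists_pow_eq'
  rw [← hi]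
  clear hi
  induction i with
  | zero => rfl
  | succ i ih => rw [pow_succ', Perm.mul_apply, hf]; exact ih

/-- Joining consecutive cycles along a path, in blocks of size `B`. -/
theorem path_join {A : Type} [Fintype A] [DecidableEq A] (σ : Perm A) (c : A → ℕ) (K B : ℕ)
    (hB : 0 < B) (hc : ∀ a b, σ.SameCycle a b ↔ c a = c b) (hK : ∀ a, c a < K)
    (x y : ℕ → A) (hx : ∀ m, m + 1 < K → c (x m) = m) (hy : ∀ m, m + 1 < K → c (y m) = m + 1)
    (r : Setoid A) (hr : ∀ m, m + 1 < K → r (x m) (y m)) :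
    ∃ σ' : Perm A, (∀ z, ∃ z', r z z' ∧ σ' z = σ z') ∧
      ∀ a b, σ'.SameCycle a b ↔ c a / B = c b / B := by
  have hcσ : ∀ z, c (σ z) = c z := fun z =>
    ((hc _ _).1 (Perm.sameCycle_apply_right.2 (Perm.SameCycle.refl σ z))).symm
  have main : ∀ M : ℕ, ∃ τ : Perm A, (∀ z, ∃ z', r z z' ∧ τ z = σ z') ∧
      (∀ a b, σ.SameCycle a b → τ.SameCycle a b) ∧
      (∀ m, m < M → m + 1 < K → (m + 1) % B ≠ 0 → τ.SameCycle (x m) (y m)) ∧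
      (∀ z, c (τ z) / B = c z / B) ∧
      (∀ t, M ≤ t → ∀ z, c (τ z) ≤ t ↔ c z ≤ t) := by
    intro M
    induction M with
    | zero =>
      exact ⟨σ, fun z => ⟨z, r.refl z, rfl⟩, fun _ _ h => h, fun m hm => absurd hm (by omega),
        fun z => by rw [hcσ], fun t _ z => by rw [hcσ]⟩
    | succ M ih =>
      obtain ⟨τ, h1, h2, h3, h4, h5⟩ := ih
      by_cases hM : M + 1 < K ∧ (M + 1) % B ≠ 0
      · obtain ⟨hMK, hMB⟩ := hM
        have cx := hx M hMK
        have cy := hy M hMK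
        have hns : ¬ τ.SameCycle (x M) (y M) := by
          intro h
          have := inv_of_sameCycle τ (fun z => c z ≤ M) (fun z => propext (h5 M le_rfl z)) h
          simp only [cx, cy, eq_iff_iff] at this
          omega
        obtain ⟨j1, j2⟩ := swap_join τ (x M) (y M) hns
        have hdiv : (M + 1) / B = M / B := by
          rw [Nat.succ_div, if_neg (fun h => hMB (Nat.mod_eq_zero_of_dvd h))]; rfl
        have hsw : ∀ z, r z (swap (x M) (y M) z) ∧ c (swap (x M) (y M) z) / B = c z / B ∧
            ∀ t, M + 1 ≤ t → (c (swap (x M) (y M) z) ≤ t ↔ c z ≤ t) := by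
          intro z
          by_cases hzx : z = x M
          · subst hzx
            rw [swap_apply_left, cx, cy]
            exact ⟨hr M hMK, hdiv, fun t ht => by omega⟩
          · by_cases hzy : z = y M
            · subst hzy
              rw [swap_apply_right, cx, cy]
              exact ⟨r.symm (hr M hMK), hdiv.symm, fun t ht => by omega⟩
            · rw [swap_apply_of_ne_of_ne hzx hzy]
              exact ⟨r.refl z, rfl, fun _ _ => Iff.rfl⟩
        refine ⟨τ * swap (x M) (y M), ?_, fun a b h => j2 a b (h2 a b h), ?_, ?_, ?_⟩
        · intro z
          obtain ⟨z', hz', e⟩ := h1 (swap (x M) (y M) z)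
          exact ⟨z', r.trans (hsw z).1 hz', e⟩
        · intro m hm hmK hmB
          by_cases hmM : m = M
          · subst hmM; exact j1
          · exact j2 _ _ (h3 m (by omega) hmK hmB)
        · intro z
          rw [Perm.mul_apply, h4, (hsw z).2.1]
        · intro t ht z
          rw [Perm.mul_apply, h5 t (by omega), (hsw z).2.2 t ht]
      · refine ⟨τ, h1, h2, ?_, h4, fun t ht => h5 t (by omega)⟩
        intro m hm hmK hmB
        by_cases hmM : m = M
        · subst hmM; exact absurd ⟨hmK, hmB⟩ hM
        · exact h3 m (by omega) hmK hmB
  obtain ⟨τ, h1, h2, h3, h4, -⟩ := main K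
  refine ⟨τ, h1, fun a b => ⟨fun h => inv_of_sameCycle τ (fun z => c z / B) h4 h, ?_⟩⟩
  have up : ∀ d a b, c b = c a + d → c a / B = c b / B → τ.SameCycle a b := by
    intro d
    induction d with
    | zero => intro a b hab _; exact h2 _ _ ((hc a b).2 (by omega))
    | succ d ih =>
      intro a b hab hdv
      have hbK := hK b
      have e1 : c a / B ≤ (c a + d) / B := Nat.div_le_div_right (by omega)
      have e2 : (c a + d) / B ≤ (c a + d + 1) / B := Nat.div_le_div_right (by omega)
      rw [hab, ← add_assoc] at hdv
      have hq : (c a + d + 1) % B ≠ 0 := by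
        intro h
        have := Nat.succ_div (a := c a + d) (b := B)
        rw [if_pos (Nat.dvd_of_mod_eq_zero h)] at this
        omega
      have cx := hx (c a + d) (by omega)
      have cy := hy (c a + d) (by omega)
      have s1 := ih a (x (c a + d)) cx (by rw [cx]; omega)
      have s2 := h3 (c a + d) (by omega) (by omega) hq
      exact (s1.trans s2).trans (h2 _ _ ((hc _ _).2 (by omega)))
  intro h
  rcases le_total (c a) (c b) with hle | hle
  · exact up (c b - c a) a b (by omega) h
  · exact (up (c a - c b) b a (by omega) h.symm).symm

/-- Sums over joined cycles. -/
theorem join_sum {A M : Type} [Fintype A] [DecidableEq A] [AddCommMonoid M] (σ σ' : Perm A)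
    (c : A → ℕ) (K B L : ℕ) (hB : 0 < B) (hBK : B ∣ K)
    (hc : ∀ a b, σ.SameCycle a b ↔ c a = c b) (hK : ∀ a, c a < K) (hs : ∀ m, m < K → ∃ a, c a = m)
    (hc' : ∀ a b, σ'.SameCycle a b ↔ c a / B = c b / B)
    (hL : ∀ a, minimalPeriod σ a = L) (h : A → M) (v : M)
    (hv : ∀ a, ∑ i ∈ Finset.range L, h (σ^[i] a) = v) (a : A) :
    ∑ i ∈ Finset.range (minimalPeriod σ' a), h (σ'^[i] a) = B • v := by
  classical
  rw [sum_cycle]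
  obtain ⟨Q, hQ⟩ := hBK
  have haQ : c a / B < Q := by
    rw [Nat.div_lt_iff_lt_mul hB, mul_comm, ← hQ]; exact hK a
  have hmaps : ∀ z ∈ Finset.univ.filter (fun z => σ'.SameCycle a z),
      c z ∈ Finset.Ico (c a / B * B) (c a / B * B + B) := by
    intro z hz
    simp only [Finset.mem_filter, Finset.mem_univ, true_and, hc'] at hz
    rw [hz, Finset.mem_Ico]
    have h1 := Nat.div_add_mod (c z) B
    have h2 := Nat.mod_lt (c z) hB
    rw [mul_comm] at h1
    omega
  rw [← Finset.sum_fiberwise_of_maps_to hmaps]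
  rw [Finset.sum_congr rfl (g := fun _ => v)]
  · simp
  · intro m hm
    rw [Finset.mem_Ico] at hm
    have hmd : m / B = c a / B := by
      apply Nat.div_eq_of_lt_le
      · exact hm.1
      · rw [Nat.succ_mul]; exact hm.2
    have hmK : m < K := by
      have : (c a / B + 1) * B ≤ Q * B := Nat.mul_le_mul_right _ haQ
      rw [Nat.succ_mul] at this
      rw [hQ, mul_comm]; omega
    obtain ⟨z, hz⟩ := hs m hmK
    rw [← hv z, ← hL z, sum_cycle]
    apply Finset.sum_congr
    · ext w
      simp only [Finset.mem_filter, Finset.mem_univ, true_and, hc, hc', hz]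
      constructor
      · rintro ⟨-, h2⟩; exact h2.symm
      · rintro h2; exact ⟨by rw [← h2, hmd], h2.symm⟩
    · intros; rfl

theorem join_period {A : Type} [Fintype A] [DecidableEq A] (σ σ' : Perm A)
    (c : A → ℕ) (K B L : ℕ) (hB : 0 < B) (hBK : B ∣ K)
    (hc : ∀ a b, σ.SameCycle a b ↔ c a = c b) (hK : ∀ a, c a < K) (hs : ∀ m, m < K → ∃ a, c a = m)
    (hc' : ∀ a b, σ'.SameCycle a b ↔ c a / B = c b / B)
    (hL : ∀ a, minimalPeriod σ a = L) (a : A) : minimalPeriod σ' a = B * L := by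
  have := join_sum σ σ' c K B L hB hBK hc hK hs hc' hL (fun _ => (1:ℕ)) L (by simp) a
  simpa using this

/-- A shift system of span `n` all of whose cycles have length `2 ^ k`. -/
structure Sys (n k : ℕ) {A : Type} (σ : Perm A) (W : A → ℕ → ZMod 2) : Prop where
  shift : ∀ a i, i + 1 < n → W (σ a) i = W a (i + 1)
  ex : ∀ x : ℕ → ZMod 2, ∃ a, ∀ i < n, W a i = x i
  inj : ∀ a b, (∀ i < n, W a i = W b i) → a = b
  per : ∀ a, minimalPeriod σ a = 2 ^ k

/-- All cycles have weight `e` modulo 2. -/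
def Wt (k : ℕ) {A : Type} (σ : Perm A) (W : A → ℕ → ZMod 2) (e : ZMod 2) : Prop :=
  ∀ a, ∑ i ∈ Finset.range (2 ^ k), W (σ^[i] a) 0 = e

/-- Every second entry of the cycles (of length `2 ^ (k+1)`) sums to zero. -/
def Bal (k : ℕ) {A : Type} (σ : Perm A) (W : A → ℕ → ZMod 2) : Prop :=
  ∀ a, ∑ i ∈ Finset.range (2 ^ k), W (σ^[2 * i] a) 0 = 0

theorem sum_pairs {M : Type} [AddCommMonoid M] (g : ℕ → M) (L : ℕ) :
    ∑ i ∈ Finset.range (2 * L), g i = ∑ i ∈ Finset.range L, (g (2 * i) + g (2 * i + 1)) := by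
  induction L with
  | zero => simp
  | succ L ih =>
    rw [Finset.sum_range_succ, ← ih, show 2 * (L + 1) = 2 * L + 1 + 1 by ring,
      Finset.sum_range_succ, Finset.sum_range_succ, add_assoc]

theorem Bal.wt {k : ℕ} {A : Type} {σ : Perm A} {W : A → ℕ → ZMod 2} (h : Bal k σ W) :
    Wt (k + 1) σ W 0 := by
  intro a
  rw [pow_succ', sum_pairs, Finset.sum_add_distrib, h a]
  have := h (σ a)
  simp only [← iterate_succ_apply] at this
  rw [this, add_zero]

/-- Lempel lift. -/
def liftPerm {A : Type} (σ : Perm A) (o : A → ZMod 2) : Perm (A × ZMod 2) where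
  toFun p := (σ p.1, p.2 + o p.1)
  invFun p := (σ.symm p.1, p.2 - o (σ.symm p.1))
  left_inv p := by simp
  right_inv p := by simp

/-- Windows of the lift. -/
def liftW {A : Type} (W : A → ℕ → ZMod 2) (p : A × ZMod 2) (i : ℕ) : ZMod 2 :=
  p.2 + ∑ j ∈ Finset.range i, W p.1 j

theorem liftPerm_iterate {A : Type} (σ : Perm A) (o : A → ZMod 2) (i : ℕ) (p : A × ZMod 2) :
    (liftPerm σ o)^[i] p = (σ^[i] p.1, p.2 + ∑ j ∈ Finset.range i, o (σ^[j] p.1)) := by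
  induction i with
  | zero => simp
  | succ i ih =>
    rw [iterate_succ_apply', ih, iterate_succ_apply', Finset.sum_range_succ, ← add_assoc]
    rfl

theorem Sys.lift {n k : ℕ} {A : Type} {σ : Perm A} {W : A → ℕ → ZMod 2} (h : Sys n k σ W)
    (hw : Wt k σ W 0) : Sys (n + 1) k (liftPerm σ (fun a => W a 0)) (liftW W) where
  shift := by
    rintro ⟨a, c⟩ i hi
    simp only [liftW, liftPerm, Equiv.coe_fn_mk]
    rw [Finset.sum_range_succ', add_assoc, add_comm (W a 0)]
    congr 2
    apply Finset.sum_congr rfl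
    intro j hj
    rw [Finset.mem_range] at hj
    exact h.shift a j (by omega)
  ex := by
    intro x
    obtain ⟨a, ha⟩ := h.ex (fun i => x (i + 1) - x i)
    refine ⟨(a, x 0), fun i hi => ?_⟩
    simp only [liftW]
    rw [Finset.sum_congr rfl (g := fun i => x (i + 1) - x i)]
    · rw [Finset.sum_range_sub]; ring
    · intro j hj
      rw [Finset.mem_range] at hj
      exact ha j (by omega)
  inj := by
    rintro ⟨a, c⟩ ⟨b, d⟩ hab
    have h0 := hab 0 (by omega)
    simp only [liftW, Finset.range_zero, Finset.sum_empty, add_zero] at h0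
    subst h0
    have : a = b := by
      apply h.inj
      intro i hi
      have h1 := hab i (by omega)
      have h2 := hab (i + 1) (by omega)
      simp only [liftW] at h1 h2
      rw [Finset.sum_range_succ, Finset.sum_range_succ, ← add_assoc, ← add_assoc, h1] at h2
      exact add_left_cancel h2
    rw [this]
  per := by
    rintro ⟨a, c⟩
    apply Nat.dvd_antisymm
    · apply IsPeriodicPt.minimalPeriod_dvd
      rw [IsPeriodicPt, IsFixedPt, liftPerm_iterate]
      simp only
      rw [hw a, add_zero, ← h.per a, iterate_minimalPeriod]
    · rw [← h.per a]
      apply IsPeriodicPt.minimalPeriod_dvd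
      have := iterate_minimalPeriod (f := liftPerm σ (fun a => W a 0)) (x := (a, c))
      rw [liftPerm_iterate] at this
      exact (Prod.ext_iff.1 this).1

theorem Bal.lift {k : ℕ} {A : Type} {σ : Perm A} {W : A → ℕ → ZMod 2} (h : Bal k σ W) :
    Wt (k + 1) (liftPerm σ (fun a => W a 0)) (liftW W) 0 := by
  rintro ⟨a, c⟩
  rw [pow_succ', sum_pairs, ← h a]
  apply Finset.sum_congr rfl
  intro i _
  simp only [liftPerm_iterate, liftW, Finset.range_zero, Finset.sum_empty, add_zero]
  rw [Finset.sum_range_succ, ← add_assoc c, ← add_assoc,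
    CharTwo.add_self_eq_zero, zero_add]

/-- Interleaving. -/
def interPerm {A : Type} (σ : Perm A) : Perm (A × A) where
  toFun p := (p.2, σ p.1)
  invFun p := (σ.symm p.2, p.1)
  left_inv p := by simp
  right_inv p := by simp

/-- Windows of the interleaving. -/
def interW {A : Type} (W : A → ℕ → ZMod 2) (p : A × A) (i : ℕ) : ZMod 2 :=
  if i % 2 = 0 then W p.1 (i / 2) else W p.2 (i / 2)

theorem interPerm_iterate {A : Type} (σ : Perm A) (i : ℕ) (p : A × A) :
    (interPerm σ)^[2 * i] p = (σ^[i] p.1, σ^[i] p.2) := by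
  induction i with
  | zero => simp
  | succ i ih =>
    rw [show 2 * (i + 1) = 2 * i + 1 + 1 by ring, iterate_succ_apply', iterate_succ_apply', ih,
      iterate_succ_apply', iterate_succ_apply']
    rfl

theorem Sys.inter {n k : ℕ} {A : Type} {σ : Perm A} {W : A → ℕ → ZMod 2} (h : Sys n k σ W)
    (hk : 0 < k) : Sys (2 * n) (k + 1) (interPerm σ) (interW W) where
  shift := by
    rintro ⟨u, v⟩ i hi
    simp only [interW, interPerm, Equiv.coe_fn_mk]
    by_cases h0 : i % 2 = 0
    · rw [if_pos h0, if_neg (by omega), show (i + 1) / 2 = i / 2 by omega]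
    · rw [if_neg h0, if_pos (by omega), show (i + 1) / 2 = i / 2 + 1 by omega]
      exact h.shift u _ (by omega)
  ex := by
    intro x
    obtain ⟨u, hu⟩ := h.ex (fun i => x (2 * i))
    obtain ⟨v, hv⟩ := h.ex (fun i => x (2 * i + 1))
    refine ⟨(u, v), fun i hi => ?_⟩
    simp only [interW]
    by_cases h0 : i % 2 = 0
    · rw [if_pos h0, hu _ (by omega)]; congr 1; omega
    · rw [if_neg h0, hv _ (by omega)]; congr 1; omega
  inj := by
    rintro ⟨u, v⟩ ⟨u', v'⟩ hab
    have h1 : u = u' := by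
      apply h.inj
      intro i hi
      have := hab (2 * i) (by omega)
      simp only [interW] at this
      rwa [if_pos (by omega), if_pos (by omega), show 2 * i / 2 = i by omega] at this
    have h2 : v = v' := by
      apply h.inj
      intro i hi
      have := hab (2 * i + 1) (by omega)
      simp only [interW] at this
      rwa [if_neg (by omega), if_neg (by omega), show (2 * i + 1) / 2 = i by omega] at this
    rw [h1, h2]
  per := by
    rintro ⟨u, v⟩
    obtain ⟨k, rfl⟩ : ∃ k', k = k' + 1 := ⟨k - 1, by omega⟩
    apply minimalPeriod_eq_prime_pow
    · intro hp
      rw [IsPeriodicPt, IsFixedPt, pow_succ', interPerm_iterate] at hp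
      have h1 : IsPeriodicPt σ (2 ^ k) u := (Prod.ext_iff.1 hp).1
      have h2 := Nat.le_of_dvd (by positivity) h1.minimalPeriod_dvd
      rw [h.per, pow_succ'] at h2
      have : 0 < 2 ^ k := by positivity
      omega
    · rw [IsPeriodicPt, IsFixedPt, pow_succ', interPerm_iterate]
      simp only
      have h1 := iterate_minimalPeriod (f := σ) (x := u)
      have h2 := iterate_minimalPeriod (f := σ) (x := v)
      rw [h.per] at h1 h2
      rw [h1, h2]

theorem Wt.inter {k : ℕ} {A : Type} {σ : Perm A} {W : A → ℕ → ZMod 2} {e : ZMod 2}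
    (h : Wt k σ W e) : Wt (k + 1) (interPerm σ) (interW W) 0 := by
  rintro ⟨u, v⟩
  rw [pow_succ', sum_pairs, Finset.sum_add_distrib]
  simp only [iterate_succ_apply', interPerm_iterate]
  simp only [interPerm, interW, Equiv.coe_fn_mk, Nat.zero_mod, if_true, Nat.zero_div]
  rw [h u, h v]
  exact CharTwo.add_self_eq_zero e

theorem Wt.inter_bal {k : ℕ} {A : Type} {σ : Perm A} {W : A → ℕ → ZMod 2}
    (h : Wt k σ W 0) : Bal k (interPerm σ) (interW W) := by
  rintro ⟨u, v⟩
  simp only [interPerm_iterate]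
  simp only [interW, Nat.zero_mod, if_true, Nat.zero_div]
  exact h u

theorem zmod_sum {M : Type} [AddCommMonoid M] (N : ℕ) [NeZero N] (f : ZMod N → M) :
    ∑ j, f j = ∑ i ∈ Finset.range N, f (i : ZMod N) := by
  refine Finset.sum_nbij' (fun j => j.val) (fun i => (i : ZMod N)) ?_ ?_ ?_ ?_ ?_
  · intro j _; simpa using ZMod.val_lt j
  · simp
  · intro j _; simp
  · intro i hi; exact ZMod.val_cast_of_lt (by simpa using hi)
  · intro j _; simp

/-- Shift on odd weight sequences. -/
def oddPerm (N : ℕ) [NeZero N] : Perm {s : ZMod N → ZMod 2 // ∑ j, s j = 1} where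
  toFun s := ⟨fun j => s.1 (j + 1), 
    (Equiv.sum_comp (Equiv.addRight (1 : ZMod N)) s.1).trans s.2⟩
  invFun s := ⟨fun j => s.1 (j - 1), 
    (Equiv.sum_comp (Equiv.subRight (1 : ZMod N)) s.1).trans s.2⟩
  left_inv s := by simp
  right_inv s := by simp

theorem oddPerm_iterate (N : ℕ) [NeZero N] (i : ℕ) (s : {s : ZMod N → ZMod 2 // ∑ j, s j = 1})
    (j : ZMod N) : ((oddPerm N)^[i] s).1 j = s.1 (j + i) := by
  induction i generalizing j with
  | zero => simp
  | succ i ih =>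
    rw [iterate_succ_apply']
    change ((oddPerm N)^[i] s).1 (j + 1) = _
    rw [ih, add_assoc]; push_cast; rw [add_comm (1 : ZMod N)]

theorem odd_sys (k : ℕ) (hk : 0 < k) :
    Sys (2 ^ k - 1) k (oddPerm (2 ^ k)) (fun s i => s.1 (i : ZMod (2 ^ k))) ∧
    Wt k (oddPerm (2 ^ k)) (fun s i => s.1 (i : ZMod (2 ^ k))) 1 := by
  have hN : 2 ^ k = (2 ^ k - 1) + 1 := by have : 0 < 2 ^ k := by positivity
                                          omega
  refine ⟨⟨?_, ?_, ?_, ?_⟩, ?_⟩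
  · intro s i hi
    change s.1 _ = _
    push_cast; rfl
  · intro x
    refine ⟨⟨fun j => if j.val < 2 ^ k - 1 then x j.val
      else 1 - ∑ i ∈ Finset.range (2 ^ k - 1), x i, ?_⟩, ?_⟩
    · rw [zmod_sum]
      have e : ∀ i ∈ Finset.range (2 ^ k), (if ((i : ZMod (2 ^ k))).val < 2 ^ k - 1 then
          x ((i : ZMod (2 ^ k))).val else 1 - ∑ i ∈ Finset.range (2 ^ k - 1), x i) =
          if i < 2 ^ k - 1 then x i else 1 - ∑ i ∈ Finset.range (2 ^ k - 1), x i := by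
        intro i hi
        rw [ZMod.val_cast_of_lt (by simpa using hi)]
      rw [Finset.sum_congr rfl e]
      conv_lhs => rw [show Finset.range (2 ^ k) = Finset.range ((2 ^ k - 1) + 1) by rw [← hN]]
      rw [Finset.sum_range_succ, if_neg (lt_irrefl _),
        Finset.sum_congr rfl (g := x) (fun i hi => if_pos (by simpa using hi))]
      ring
    · intro i hi
      simp only
      rw [ZMod.val_cast_of_lt (by omega), if_pos hi]
  · intro s t hst
    have hs := s.2
    have ht := t.2
    rw [zmod_sum] at hs ht
    rw [show Finset.range (2 ^ k) = Finset.range ((2 ^ k - 1) + 1) by rw [← hN],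
      Finset.sum_range_succ] at hs ht
    rw [Finset.sum_congr rfl (fun i hi => hst i (by simpa using hi))] at hs
    have hl := add_left_cancel (hs.trans ht.symm)
    apply Subtype.ext
    funext j
    have hj := ZMod.val_lt j
    rw [← ZMod.natCast_zmod_val j]
    by_cases h : j.val < 2 ^ k - 1
    · exact hst _ h
    · rw [show j.val = 2 ^ k - 1 by omega]; exact hl
  · intro s
    obtain ⟨k, rfl⟩ : ∃ k', k = k' + 1 := ⟨k - 1, by omega⟩
    apply minimalPeriod_eq_prime_pow
    · intro hp
      have hs := s.2
      have h2 : ∀ j, s.1 (j + (2 ^ k : ℕ)) = s.1 j := by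
        intro j
        rw [← oddPerm_iterate, hp.eq]
      rw [zmod_sum] at hs
      rw [show Finset.range (2 ^ (k + 1)) = Finset.range (2 ^ k + 2 ^ k) by
        rw [pow_succ']; congr 1; ring, Finset.sum_range_add] at hs
      rw [Finset.sum_congr rfl (g := fun i => s.1 ((i : ℕ) : ZMod (2 ^ (k + 1))))
        (s₁ := Finset.range (2 ^ k)) (s₂ := Finset.range (2 ^ k)) (f := fun i => s.1 ((2 ^ k + i : ℕ) : ZMod (2 ^ (k + 1)))), CharTwo.add_self_eq_zero] at hs
      · exact absurd hs (by decide)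
      · intro i _
        rw [← h2 i]
        exact congrArg s.1 (by push_cast; ring)
    · apply Subtype.ext
      funext j
      rw [oddPerm_iterate, ZMod.natCast_self, add_zero]
  · intro s
    simp only [oddPerm_iterate]
    refine Eq.trans ?_ s.2
    rw [zmod_sum]
    simp

theorem Sys.bij {n k : ℕ} {A : Type} {σ : Perm A} {W : A → ℕ → ZMod 2} (h : Sys n k σ W) :
    Function.Bijective (fun (a : A) (i : Fin n) => W a i) := by
  constructor
  · intro a b hab
    exact h.inj a b (fun i hi => congrFun hab ⟨i, hi⟩)
  · intro x
    obtain ⟨a, ha⟩ := h.ex (fun i => if hi : i < n then x ⟨i, hi⟩ else 0)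
    refine ⟨a, funext fun i => ?_⟩
    simp only
    rw [ha i i.2, dif_pos i.2]

theorem add_one_iterate {R : Type} [Ring R] (m : ℕ) (j : R) :
    (Equiv.addRight (1 : R))^[m] j = j + m := by
  induction m with
  | zero => simp
  | succ m ih => rw [iterate_succ_apply', ih]; simp [add_assoc]

/-- A system with a single cycle can be put on `ZMod (2 ^ n)`. -/
theorem Sys.debruijn {n : ℕ} {A : Type} {σ : Perm A} {W : A → ℕ → ZMod 2} (h : Sys n n σ W)
    {e : ZMod 2} (hw : Wt n σ W e) :
    ∃ V : ZMod (2 ^ n) → ℕ → ZMod 2, Sys n n (Equiv.addRight 1) V ∧ (∀ i < n, V 0 i = 0) ∧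
      Wt n (Equiv.addRight (1 : ZMod (2 ^ n))) V e := by
  obtain ⟨z, hz⟩ := h.ex (fun _ => 0)
  let f : ZMod (2 ^ n) → A := fun j => σ^[j.val] z
  have fnat : ∀ i : ℕ, f (i : ZMod (2 ^ n)) = σ^[i] z := by
    intro i
    simp only [f]
    rw [ZMod.val_natCast, ← h.per z, iterate_mod_minimalPeriod_eq]
  have fadd : ∀ (m : ℕ) (j : ZMod (2 ^ n)), f (j + m) = σ^[m] (f j) := by
    intro m j
    conv_lhs => rw [← ZMod.natCast_zmod_val j, ← Nat.cast_add, fnat, add_comm, iterate_add_apply]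
  have finj : Function.Injective f := by
    intro i j hij
    apply ZMod.val_injective
    refine (iterate_injOn_Iio_minimalPeriod (f := σ) (x := z)) ?_ ?_ hij
    · rw [h.per]; exact ZMod.val_lt i
    · rw [h.per]; exact ZMod.val_lt j
  have : Fintype A := Fintype.ofBijective _ (Equiv.ofBijective _ h.bij).symm.bijective
  have hcard : Fintype.card (ZMod (2 ^ n)) = Fintype.card A := by
    rw [Fintype.card_congr (Equiv.ofBijective _ h.bij)]
    simp [ZMod.card]
  have fbij : Function.Bijective f := (Fintype.bijective_iff_injective_and_card f).2 ⟨finj, hcard⟩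
  refine ⟨fun j => W (f j), ⟨?_, ?_, ?_, ?_⟩, ?_, ?_⟩
  · intro j i hi
    have := fadd 1 j
    rw [Nat.cast_one] at this
    change W (f (j + 1)) i = _
    rw [this]
    exact h.shift _ _ hi
  · intro x
    obtain ⟨a, ha⟩ := h.ex x
    obtain ⟨j, rfl⟩ := fbij.2 a
    exact ⟨j, ha⟩
  · intro a b hab
    exact finj (h.inj _ _ hab)
  · intro j
    apply Nat.dvd_antisymm
    · apply IsPeriodicPt.minimalPeriod_dvd
      rw [IsPeriodicPt, IsFixedPt, add_one_iterate, ZMod.natCast_self, add_zero]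
    · have := iterate_minimalPeriod (f := Equiv.addRight (1 : ZMod (2 ^ n))) (x := j)
      rw [add_one_iterate] at this
      rw [← ZMod.natCast_eq_zero_iff]
      simpa using this
  · intro i hi
    have := fnat 0
    rw [Nat.cast_zero] at this
    simp only
    rw [this]; exact hz i hi
  · intro j
    simp only [add_one_iterate, fadd]
    exact hw _

/-- The joined system is still a shift system. -/
theorem Sys.joined {n k t l : ℕ} {A : Type} {σ : Perm A} {W : A → ℕ → ZMod 2} (h : Sys n k σ W)
    (σ' : Perm A) (h1 : ∀ z, ∃ z', (∀ i, 0 < i → i < n → W z i = W z' i) ∧ σ' z = σ z')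
    (h2 : ∀ a, minimalPeriod σ' a = t) (ht : t = 2 ^ l) : Sys n l σ' W where
  shift := by
    intro a i hi
    obtain ⟨z', e1, e2⟩ := h1 a
    rw [e2, h.shift _ _ hi, e1 _ (by omega) hi]
  ex := h.ex
  inj := h.inj
  per := fun a => by rw [h2, ht]

theorem phase_sum {A : Type} (τ : Perm A) (p : A → ZMod 2) (hp : ∀ z, p (τ z) = p z + 1)
    (g : A → ZMod 2) (ε : ZMod 2) (L : ℕ) (z : A) :
    ∑ i ∈ Finset.range (2 * L), (if p (τ^[i] z) = ε then g (τ^[i] z) else 0) =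
      if p z = ε then ∑ i ∈ Finset.range L, g (τ^[2 * i] z)
        else ∑ i ∈ Finset.range L, g (τ^[2 * i] (τ z)) := by
  have hpi : ∀ i : ℕ, p (τ^[i] z) = p z + i := by
    intro i
    induction i with
    | zero => simp
    | succ i ih => rw [iterate_succ_apply', hp, ih]; push_cast; ring
  have h2 : (2 : ZMod 2) = 0 := rfl
  rw [sum_pairs]
  simp only [hpi, Nat.cast_add, Nat.cast_mul, Nat.cast_ofNat, Nat.cast_one, h2, zero_mul,
    zero_add, add_zero]
  have d1 : ∀ ε : ZMod 2, ¬ ε + 1 = ε := by decide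
  have d2 : ∀ q ε : ZMod 2, q ≠ ε → q + 1 = ε := by decide
  by_cases h : p z = ε
  · simp [h, d1 ε]
  · have h' : p z + 1 = ε := d2 _ _ h
    simp only [h', h, if_true, if_false, zero_add, iterate_succ_apply]

theorem val_neg_one_sub (N : ℕ) [NeZero N] (x : ZMod N) : (-1 - x).val = N - 1 - x.val := by
  have hx := ZMod.val_lt x
  have : -1 - x = ((N - 1 - x.val : ℕ) : ZMod N) := by
    rw [Nat.cast_sub (by omega), Nat.cast_sub (by omega)]
    simp
  rw [this, ZMod.val_cast_of_lt (by omega)]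

/-- Label of the cycles of the interleaving of a de Bruijn sequence with itself. -/
def lab (N : ℕ) (z : ZMod N × ZMod N) : ℕ :=
  min (z.2 - z.1 - 1).val (N - 1 - (z.2 - z.1 - 1).val)

theorem lab_step (N : ℕ) [NeZero N] (z : ZMod N × ZMod N) :
    lab N (interPerm (Equiv.addRight 1) z) = lab N z := by
  obtain ⟨a, b⟩ := z
  simp only [lab, interPerm, Equiv.coe_fn_mk, Equiv.coe_addRight]
  have h1 : a + 1 - b - 1 = -1 - (b - a - 1) := by ring
  have hx := ZMod.val_lt (b - a - 1)
  rw [h1, val_neg_one_sub]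
  omega

theorem lab_same (N : ℕ) [NeZero N] (z w : ZMod N × ZMod N) :
    (interPerm (Equiv.addRight (1 : ZMod N))).SameCycle z w ↔ lab N z = lab N w := by
  constructor
  · intro h
    exact inv_of_sameCycle _ (lab N) (lab_step N) h
  · have key : ∀ z w : ZMod N × ZMod N, z.2 - z.1 = w.2 - w.1 →
        (interPerm (Equiv.addRight (1 : ZMod N))).SameCycle z w := by
      rintro ⟨a, b⟩ ⟨a', b'⟩ h
      simp only at h
      refine ⟨(2 * (a' - a).val : ℕ), ?_⟩
      rw [zpow_natCast, ← Perm.iterate_eq_pow, interPerm_iterate, add_one_iterate, add_one_iterate]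
      simp only [ZMod.natCast_zmod_val]
      refine Prod.ext (by simp) ?_
      simp only
      linear_combination h
    intro h
    have hz := ZMod.val_lt (z.2 - z.1 - 1)
    have hw := ZMod.val_lt (w.2 - w.1 - 1)
    have h' : (z.2 - z.1 - 1).val = (w.2 - w.1 - 1).val ∨
        (z.2 - z.1 - 1).val = (-1 - (w.2 - w.1 - 1)).val := by
      rw [val_neg_one_sub]
      simp only [lab] at h
      omega
    rcases h' with h' | h'
    · apply key
      linear_combination ZMod.val_injective N h'
    · rw [← Perm.sameCycle_apply_right]
      apply key
      simp only [interPerm, Equiv.coe_fn_mk, Equiv.coe_addRight]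
      linear_combination ZMod.val_injective N h'

theorem inter_join_aux {m i N : ℕ} [NeZero N] (hN : N = 2 ^ (m + 1)) (hi : i < m + 1)
    (V : ZMod N → ℕ → ZMod 2)
    (h : Sys (m + 1) (m + 1) (Equiv.addRight 1) V) (h0 : ∀ i < m + 1, V 0 i = 0)
    (hw : Wt (m + 1) (Equiv.addRight (1 : ZMod N)) V 0) :
    ∃ σ' : Perm (ZMod N × ZMod N), Sys (2 * (m + 1)) (m + 1 + i + 1) σ' (interW V) ∧
      Bal (m + 1 + i) σ' (interW V) := by
  classical
  have hN2 : N = 2 * 2 ^ m := by rw [hN, pow_succ']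
  have hH : 0 < 2 ^ m := by positivity
  set σ₀ := Equiv.addRight (1 : ZMod N) with hσ₀
  set τ := interPerm σ₀ with hτ
  have hS : Sys (2 * (m + 1)) (m + 1 + 1) τ (interW V) := h.inter (by omega)
  have hSb : Bal (m + 1) τ (interW V) := hw.inter_bal
  let φ : ZMod N →+* ZMod 2 := ZMod.castHom (by rw [hN2]; exact dvd_mul_right _ _) (ZMod 2)
  let p : ZMod N × ZMod N → ZMod 2 := fun z => φ z.1 + φ z.2 + (lab N z : ℕ)
  have hp : ∀ z, p (τ z) = p z + 1 := by
    intro z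
    simp only [p, hτ]
    rw [lab_step]
    simp only [interPerm, Equiv.coe_fn_mk, hσ₀, Equiv.coe_addRight, map_add, map_one]
    ring
  let r : Setoid (ZMod N × ZMod N) := Setoid.ker
    (fun z => ((fun i => if 0 < i ∧ i < 2 * (m + 1) then interW V z i else 0), p z))
  have hr : ∀ z w, r z w ↔ (∀ i, 0 < i → i < 2 * (m + 1) → interW V z i = interW V w i) ∧ p z = p w := by
    intro z w
    change (_, _) = (_, _) ↔ _
    rw [Prod.mk.injEq]
    refine and_congr_left fun _ => ⟨fun h i h1 h2 => ?_, fun h => funext fun i => ?_⟩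
    · have := congrFun h i
      simpa only [if_pos (And.intro h1 h2)] using this
    · split_ifs with hh
      · exact h i hh.1 hh.2
      · rfl
  let x : ℕ → ZMod N × ZMod N := fun j => (0, ((j + 1 : ℕ) : ZMod N))
  let y : ℕ → ZMod N × ZMod N := fun j => (-1, ((j + 1 : ℕ) : ZMod N))
  have hx : ∀ j, j < 2 ^ m → lab N (x j) = j := by
    intro j hj
    simp only [lab, x]
    rw [show ((j + 1 : ℕ) : ZMod N) - 0 - 1 = (j : ℕ) by push_cast; ring,
      ZMod.val_cast_of_lt (by omega)]
    omega
  have hy : ∀ j, j + 1 < 2 ^ m → lab N (y j) = j + 1 := by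
    intro j hj
    simp only [lab, y]
    rw [show ((j + 1 : ℕ) : ZMod N) - -1 - 1 = (j + 1 : ℕ) by push_cast; ring,
      ZMod.val_cast_of_lt (by omega)]
    omega
  have hK : ∀ z, lab N z < 2 ^ m := by
    intro z
    have := ZMod.val_lt (z.2 - z.1 - 1)
    simp only [lab]
    omega
  obtain ⟨σ', h1, h2⟩ := path_join τ (lab N) (2 ^ m) (2 ^ i) (by positivity) (lab_same N) hK x y
    (fun j hj => hx j (by omega)) hy r (by
      intro j hj
      rw [hr]
      constructor
      · intro l l1 l2
        simp only [interW, x, y]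
        by_cases hl : l % 2 = 0
        · rw [if_pos hl, if_pos hl, h0 _ (by omega)]
          have := h.shift (-1) (l / 2 - 1) (by omega)
          rw [show l / 2 - 1 + 1 = l / 2 by omega] at this
          rw [← this]
          have e0 : σ₀ (-1 : ZMod N) = 0 := neg_add_cancel 1
          rw [e0, h0 _ (by omega)]
        · rw [if_neg hl, if_neg hl]
      · simp only [p]
        rw [hx j (by omega), hy j hj]
        simp only [x, y, map_zero, map_neg, map_one]
        push_cast
        ring)
  have hs : ∀ j, j < 2 ^ m → ∃ a, lab N a = j := fun j hj => ⟨x j, hx j hj⟩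
  have hdvd : 2 ^ i ∣ 2 ^ m := pow_dvd_pow 2 (by omega)
  have hper := join_period τ σ' (lab N) (2 ^ m) (2 ^ i) _ (by positivity) hdvd (lab_same N) hK hs h2
    hS.per
  have hpe : 2 ^ i * 2 ^ (m + 1 + 1) = 2 ^ (m + 1 + i + 1) := by rw [← pow_add]; congr 1; omega
  refine ⟨σ', hS.joined σ' ?_ hper hpe, ?_⟩
  · intro z
    obtain ⟨z', e1, e2⟩ := h1 z
    exact ⟨z', ((hr _ _).1 e1).1, e2⟩
  · intro a
    have hp' : ∀ z, p (σ' z) = p z + 1 := by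
      intro z
      obtain ⟨z', e1, e2⟩ := h1 z
      rw [e2, hp, ((hr _ _).1 e1).2]
    have := join_sum τ σ' (lab N) (2 ^ m) (2 ^ i) _ (by positivity) hdvd (lab_same N) hK hs h2
      hS.per (fun z => if p z = p a then interW V z 0 else 0) 0 (by
        intro z
        rw [pow_succ' 2 (m + 1), phase_sum τ p hp (fun z => interW V z 0)]
        rw [hSb z, hSb (τ z), ite_self]) a
    rw [hper, hpe, pow_succ', phase_sum σ' p hp' (fun z => interW V z 0), if_pos rfl, smul_zero] at this
    exact this

theorem inter_join {n i : ℕ} (hi : i < n) (V : ZMod (2 ^ n) → ℕ → ZMod 2)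
    (h : Sys n n (Equiv.addRight 1) V) (h0 : ∀ i < n, V 0 i = 0)
    (hw : Wt n (Equiv.addRight (1 : ZMod (2 ^ n))) V 0) :
    ∃ σ' : Perm (ZMod (2 ^ n) × ZMod (2 ^ n)), Sys (2 * n) (n + i + 1) σ' (interW V) ∧
      Bal (n + i) σ' (interW V) := by
  obtain ⟨m, rfl⟩ : ∃ m, n = m + 1 := ⟨n - 1, by omega⟩
  exact inter_join_aux rfl hi V h h0 hw

/-- The Lempel construction: lift a single cycle of weight zero to two cycles, and join them. -/
theorem lempel_join {N M : ℕ} [NeZero M] (hM : M = 2 ^ N) (hN : 2 ≤ N) (V : ZMod M → ℕ → ZMod 2)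
    (h : Sys N N (Equiv.addRight 1) V) (hw : Wt N (Equiv.addRight (1 : ZMod M)) V 0) :
    ∃ σ' : Perm (ZMod M × ZMod 2), Sys (N + 1) (N + 1) σ' (liftW V) ∧
      Wt (N + 1) σ' (liftW V) 0 := by
  classical
  have hS := h.lift hw
  set τ := liftPerm (Equiv.addRight (1 : ZMod M)) (fun a => V a 0) with hτ
  let S : ℕ → ZMod 2 := fun j => ∑ i ∈ Finset.range j, V (i : ZMod M) 0
  let ψ : ZMod M → ZMod 2 := fun a => S a.val
  have hSM : S M = 0 := by
    have := hw 0
    simp only [add_one_iterate, zero_add, ← hM] at this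
    exact this
  have hψn : ∀ j ≤ M, ψ (j : ZMod M) = S j := by
    intro j hj
    rcases hj.lt_or_eq with hj | rfl
    · simp only [ψ]
      rw [ZMod.val_cast_of_lt hj]
    · rw [hSM]
      simp [ψ, S]
  have hψ : ∀ a, ψ (a + 1) = ψ a + V a 0 := by
    intro a
    have e : a + 1 = ((a.val + 1 : ℕ) : ZMod M) := by simp
    rw [e, hψn _ (ZMod.val_lt a)]
    simp only [S, ψ]
    rw [Finset.sum_range_succ, ZMod.natCast_zmod_val]
  let c : ZMod M × ZMod 2 → ℕ := fun z => (z.2 + ψ z.1).val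
  have hcτ : ∀ z, c (τ z) = c z := by
    rintro ⟨a, d⟩
    simp only [c, hτ, liftPerm, Equiv.coe_fn_mk, Equiv.coe_addRight, hψ]
    congr 1
    rw [show d + V a 0 + (ψ a + V a 0) = d + ψ a + (V a 0 + V a 0) by ring,
      CharTwo.add_self_eq_zero, add_zero]
  have base : ∀ z : ZMod M × ZMod 2, τ.SameCycle (0, z.2 + ψ z.1) z := by
    rintro ⟨a, d⟩
    refine ⟨(a.val : ℕ), ?_⟩
    rw [zpow_natCast, ← Perm.iterate_eq_pow, hτ, liftPerm_iterate]
    simp only [add_one_iterate, zero_add, ZMod.natCast_zmod_val]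
    have : d + ψ a + ∑ j ∈ Finset.range a.val, V (j : ZMod M) 0 = d := by
      change d + ψ a + ψ a = d
      rw [add_assoc, CharTwo.add_self_eq_zero, add_zero]
    rw [this]
  have hc : ∀ z w, τ.SameCycle z w ↔ c z = c w := by
    intro z w
    refine ⟨fun hh => inv_of_sameCycle τ c hcτ hh, fun hh => ?_⟩
    have e := ZMod.val_injective 2 hh
    have b1 := base z
    rw [e] at b1
    exact b1.symm.trans (base w)
  have hK : ∀ z, c z < 2 := fun z => ZMod.val_lt (z.2 + ψ z.1)
  obtain ⟨a, ha⟩ := h.ex (fun _ => 1)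
  have hsh : ∀ i, i + 1 < N → V (a - 1) (i + 1) = 1 := by
    intro i hi
    rw [← h.shift (a - 1) i hi]
    simp only [Equiv.coe_addRight, sub_add_cancel]
    exact ha i (by omega)
  have hM1 : 1 < M := by
    rw [hM]; exact Nat.one_lt_two_pow (by omega)
  have hV0 : V (a - 1) 0 = 0 := by
    by_contra hne
    have h1 : V (a - 1) 0 = 1 := by
      generalize V (a - 1) 0 = q at hne
      revert q; decide
    have := h.inj (a - 1) a (by
      intro i hi
      rw [ha i hi]
      rcases i with _ | i
      · exact h1
      · exact hsh i hi)
    have h10 : (1 : ZMod M) = 0 := by linear_combination -this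
    have := congrArg ZMod.val h10
    rw [ZMod.val_one'' (by omega), ZMod.val_zero] at this
    omega
  have hψa : ψ a = ψ (a - 1) := by
    have := hψ (a - 1)
    rwa [sub_add_cancel, hV0, add_zero] at this
  let r : Setoid (ZMod M × ZMod 2) := Setoid.ker
    (fun z => (fun i => if 0 < i ∧ i < N + 1 then liftW V z i else 0))
  have hr : ∀ z w, r z w ↔ ∀ i, 0 < i → i < N + 1 → liftW V z i = liftW V w i := by
    intro z w
    change (fun i => _) = (fun i => _) ↔ _
    refine ⟨fun h i h1 h2 => ?_, fun h => funext fun i => ?_⟩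
    · have := congrFun h i
      simpa only [if_pos (And.intro h1 h2)] using this
    · split_ifs with hh
      · exact h i hh.1 hh.2
      · rfl
  have cx : c (a, ψ a) = 0 := by
    simp only [c]; rw [CharTwo.add_self_eq_zero, ZMod.val_zero]
  have cy : c (a - 1, ψ a + 1) = 1 := by
    simp only [c]
    rw [← hψa, show ψ a + 1 + ψ a = 1 + (ψ a + ψ a) by ring, CharTwo.add_self_eq_zero]
    rfl
  obtain ⟨σ', h1, h2⟩ := path_join τ c 2 2 (by norm_num) hc hK (fun _ => (a, ψ a))
    (fun _ => (a - 1, ψ a + 1))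
    (fun m hm => by rw [cx]; omega) (fun m hm => by rw [cy]; omega) r (by
      intro m _
      rw [hr]
      intro i h1 h2
      simp only [liftW]
      obtain ⟨j, rfl⟩ : ∃ j, i = j + 1 := ⟨i - 1, by omega⟩
      rw [Finset.sum_range_succ, Finset.sum_range_succ', hV0, ha j (by omega),
        Finset.sum_congr rfl (g := fun _ => 1) (fun x hx => ha x (by
          rw [Finset.mem_range] at hx; omega)),
        Finset.sum_congr rfl (g := fun _ => 1) (f := fun x => V (a - 1) (x + 1))
          (fun x hx => hsh x (by rw [Finset.mem_range] at hx; omega))]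
      ring)
  have hs : ∀ j, j < 2 → ∃ z, c z = j := by
    intro j hj
    rcases j with _ | j
    · exact ⟨_, cx⟩
    · exact ⟨_, by rw [cy]; omega⟩
  have hper := join_period τ σ' c 2 2 _ (by norm_num) dvd_rfl hc hK hs h2 hS.per
  have hpe : 2 * 2 ^ N = 2 ^ (N + 1) := by rw [pow_succ']
  refine ⟨σ', hS.joined σ' ?_ hper hpe, ?_⟩
  · intro z
    obtain ⟨z', e1, e2⟩ := h1 z
    exact ⟨z', (hr _ _).1 e1, e2⟩
  · intro z
    rw [← hpe, ← hper z, sum_cycle σ' z (fun z => liftW V z 0)]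
    rw [Finset.filter_true_of_mem]
    · simp only [liftW, Finset.range_zero, Finset.sum_empty, add_zero]
      rw [Fintype.sum_prod_type]
      have e1 : ∑ e : ZMod 2, e = 1 := by decide
      simp only [e1, Finset.sum_const, Finset.card_univ, ZMod.card, nsmul_eq_mul, mul_one]
      rw [hM, Nat.cast_pow]
      exact zero_pow (by omega)
    · intro w _
      rw [h2, Nat.div_eq_of_lt (hK z), Nat.div_eq_of_lt (hK w)]

/-- The existence claim. -/
def Good (n k : ℕ) (e : ZMod 2) : Prop :=
  ∃ (A : Type) (σ : Perm A) (W : A → ℕ → ZMod 2), Sys n k σ W ∧ Wt k σ W e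

theorem succ_lt_two_pow (m : ℕ) (hm : 2 ≤ m) : m + 1 < 2 ^ m := by
  induction m, hm using Nat.le_induction with
  | base => norm_num
  | succ m hm ih => rw [pow_succ]; omega

theorem bal_sys (m k : ℕ) (hk : k + 1 ≤ 2 * m) (hk1 : 1 ≤ k) (hmk : m + 1 < 2 ^ k)
    (G : ∀ k, 1 ≤ k → k ≤ m → m + 1 < 2 ^ k → Good m k 0) :
    ∃ (A : Type) (σ : Perm A) (W : A → ℕ → ZMod 2), Sys (2 * m) (k + 1) σ W ∧ Bal k σ W := by
  rcases le_or_gt k m with hkm | hkm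
  · obtain ⟨A, σ, W, h, hw⟩ := G k hk1 hkm hmk
    exact ⟨_, _, _, h.inter hk1, hw.inter_bal⟩
  · have hm : 2 ≤ m := by omega
    have hmm : m + 1 < 2 ^ m := succ_lt_two_pow m hm
    obtain ⟨A, σ, W, h, hw⟩ := G m (by omega) le_rfl hmm
    obtain ⟨V, h1, h2, h3⟩ := h.debruijn hw
    obtain ⟨σ', h4, h5⟩ := inter_join (i := k - m) (by omega) V h1 h2 h3
    rw [show m + (k - m) = k by omega] at h4 h5
    exact ⟨_, _, _, h4, h5⟩

theorem good_odd (n k : ℕ) (hk : 1 ≤ k) (h : n + 1 = 2 ^ k) : Good n k 1 := by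
  have := odd_sys k hk
  rw [show 2 ^ k - 1 = n by omega] at this
  exact ⟨_, _, _, this⟩

theorem good_zero : ∀ n k : ℕ, 1 ≤ k → k ≤ n → n + 1 < 2 ^ k → Good n k 0 := by
  intro n
  induction n using Nat.strong_induction_on with
  | _ n ih =>
  intro k hk hkn hnk
  obtain ⟨k, rfl⟩ : ∃ k', k = k' + 1 := ⟨k - 1, by omega⟩
  have hk0 : 1 ≤ k := by
    by_contra hh
    have : k = 0 := by omega
    subst this
    norm_num at hnk
    omega
  rw [pow_succ] at hnk
  obtain ⟨m, rfl | rfl⟩ : ∃ m, n = 2 * m ∨ n = 2 * m + 1 := ⟨n / 2, by omega⟩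
  · by_cases hm1 : m + 1 = 2 ^ k
    · obtain ⟨A, σ, W, h, hw⟩ := good_odd m k hk0 hm1
      exact ⟨_, _, _, h.inter hk0, hw.inter⟩
    · obtain ⟨A, σ, W, h, hw⟩ := bal_sys m k hkn hk0 (by omega) (ih m (by omega))
      exact ⟨_, _, _, h, hw.wt⟩
  · by_cases hk2 : k + 1 ≤ 2 * m
    · obtain ⟨A, σ, W, h, hw⟩ := bal_sys m k hk2 hk0 (by omega) (ih m (by omega))
      exact ⟨_, _, _, h.lift hw.wt, hw.lift⟩
    · have : k = 2 * m := by omega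
      subst this
      obtain ⟨A, σ, W, h, hw⟩ := ih (2 * m) (by omega) (2 * m) hk0 le_rfl (succ_lt_two_pow _ (by omega))
      obtain ⟨V, h1, h2, h3⟩ := h.debruijn hw
      obtain ⟨σ', h4, h5⟩ := lempel_join rfl (by omega) V h1 h3
      exact ⟨_, _, _, h4, h5⟩

theorem exists_sys (n k : ℕ) (hk : 1 ≤ k) (hkn : k ≤ n) (hnk : n < 2 ^ k) :
    ∃ (A : Type) (σ : Perm A) (W : A → ℕ → ZMod 2), Sys n k σ W := by
  by_cases h : n + 1 = 2 ^ k
  · obtain ⟨A, σ, W, h, -⟩ := good_odd n k hk h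
    exact ⟨A, σ, W, h⟩
  · obtain ⟨A, σ, W, h, -⟩ := good_zero n k hk hkn (by omega)
    exact ⟨A, σ, W, h⟩

theorem Sys.window {n k : ℕ} {A : Type} {σ : Perm A} {W : A → ℕ → ZMod 2} (h : Sys n k σ W)
    (j : ℕ) : ∀ (a : A) (i : ℕ), i + j < n → W (σ^[j] a) i = W a (i + j) := by
  induction j with
  | zero => intro a i _; rfl
  | succ j ih =>
    intro a i hi
    rw [iterate_succ_apply', h.shift _ _ (by omega), ih _ _ (by omega)]
    congr 1; omega

theorem Sys.isPF {n k : ℕ} (hn : 0 < n) {A : Type} {σ : Perm A} {W : A → ℕ → ZMod 2}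
    (h : Sys n k σ W) :
    ∃ Δ : ℕ, 0 < Δ ∧ ∃ F : Fin Δ → (ZMod (2 ^ k) → ZMod 2), IsPF n k Δ F := by
  classical
  have fA : Fintype A := Fintype.ofBijective _ (Equiv.ofBijective _ h.bij).symm.bijective
  let Q := Quotient (Perm.SameCycle.setoid σ)
  have fQ : Fintype Q := Fintype.ofFinite Q
  let e : Fin (Fintype.card Q) ≃ Q := (Fintype.equivFin Q).symm
  obtain ⟨a0, -⟩ := h.ex (fun _ => 0)
  have fnat : ∀ (z : A) (i : ℕ), σ^[(i : ZMod (2 ^ k)).val] z = σ^[i] z := by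
    intro z i
    rw [ZMod.val_natCast, ← h.per z, iterate_mod_minimalPeriod_eq]
  have fadd : ∀ (z : A) (m : ℕ) (j : ZMod (2 ^ k)), σ^[(j + m).val] z = σ^[m] (σ^[j.val] z) := by
    intro z m j
    conv_lhs => rw [← ZMod.natCast_zmod_val j, ← Nat.cast_add, fnat, add_comm, iterate_add_apply]
  let g : Fin (Fintype.card Q) × ZMod (2 ^ k) → A := fun p => σ^[p.2.val] (e p.1).out
  have hout : ∀ q : Q, (Quotient.mk (Perm.SameCycle.setoid σ) q.out) = q := fun q => Quotient.out_eq q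
  have gq : ∀ p, Quotient.mk (Perm.SameCycle.setoid σ) (g p) = e p.1 := by
    intro p
    refine Eq.trans ?_ (hout (e p.1))
    apply Quotient.sound
    refine Perm.SameCycle.symm ⟨(p.2.val : ℕ), ?_⟩
    rw [zpow_natCast, ← Perm.iterate_eq_pow]
  have gbij : Function.Bijective g := by
    constructor
    · rintro ⟨u, j⟩ ⟨v, l⟩ huv
      have h1 : u = v := by
        apply e.injective
        rw [← gq (u, j), ← gq (v, l), huv]
      subst h1
      refine Prod.ext rfl ?_
      apply ZMod.val_injective
      refine (iterate_injOn_Iio_minimalPeriod (f := σ) (x := (e u).out)) ?_ ?_ huv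
      · rw [h.per]; exact ZMod.val_lt j
      · rw [h.per]; exact ZMod.val_lt l
    · intro a
      have hs : σ.SameCycle (Quotient.mk (Perm.SameCycle.setoid σ) a).out a :=
        Quotient.exact (hout (Quotient.mk (Perm.SameCycle.setoid σ) a))
      obtain ⟨i, -, hi⟩ := hs.exists_pow_eq'
      refine ⟨(e.symm (Quotient.mk (Perm.SameCycle.setoid σ) a), (i : ZMod (2 ^ k))), ?_⟩
      simp only [g]
      rw [fnat, Equiv.apply_symm_apply, Perm.iterate_eq_pow, hi]
  refine ⟨Fintype.card Q, Fintype.card_pos_iff.2 ⟨Quotient.mk _ a0⟩,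
    fun u j => W (g (u, j)) 0, ?_⟩
  have hF : ∀ (p : Fin (Fintype.card Q) × ZMod (2 ^ k)) (i : ℕ), i < n →
      W (g (p.1, p.2 + (i : ℕ))) 0 = W (g p) i := by
    intro p i hi
    simp only [g]
    rw [fadd, h.window i _ 0 (by omega), zero_add]
  intro x
  obtain ⟨p, hp⟩ := (h.bij.comp gbij).2 x
  refine ⟨p, ?_, ?_⟩
  · intro i
    simp only
    rw [hF p i i.2]
    exact congrFun hp i
  · intro q hq
    apply (h.bij.comp gbij).1
    rw [hp]
    funext i
    have := hq i
    simp only at this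
    rw [hF q i i.2] at this
    exact this

theorem isPF_card {n k Δ : ℕ} {F : Fin Δ → (ZMod (2 ^ k) → ZMod 2)} (h : IsPF n k Δ F) :
    Δ * 2 ^ k = 2 ^ n := by
  have hb : Function.Bijective (fun (p : Fin Δ × ZMod (2 ^ k)) (i : Fin n) =>
      F p.1 (p.2 + ((i : ℕ) : ZMod (2 ^ k)))) := by
    constructor
    · intro p q hpq
      obtain ⟨r, -, hr⟩ := h (fun i => F p.1 (p.2 + ((i : ℕ) : ZMod (2 ^ k))))
      rw [hr p (fun i => rfl), hr q (fun i => (congrFun hpq i).symm)]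
    · intro x
      obtain ⟨r, hr, -⟩ := h x
      exact ⟨r, funext hr⟩
  have := Fintype.card_congr (Equiv.ofBijective _ hb)
  simpa [ZMod.card] using this

theorem isPF_lt {n k Δ : ℕ} (hk : 0 < k) {F : Fin Δ → (ZMod (2 ^ k) → ZMod 2)}
    (h : IsPF n k Δ F) : n < 2 ^ k := by
  by_contra hn
  push Not at hn
  obtain ⟨⟨u, j⟩, h1, h2⟩ := h (fun _ => 0)
  simp only at h1
  have hz : ∀ l, F u l = 0 := by
    intro l
    have := h1 ⟨(l - j).val, (ZMod.val_lt _).trans_le hn⟩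
    simpa using this
  have := h2 (u, j + 1) (fun i => hz _)
  have h10 : (1 : ZMod (2 ^ k)) = 0 := by
    have := (Prod.ext_iff.1 this).2
    simp only at this
    linear_combination this
  have hM1 : 1 < 2 ^ k := Nat.one_lt_two_pow (by omega)
  have := congrArg ZMod.val h10
  rw [ZMod.val_one'' (by omega), ZMod.val_zero] at this
  omega

theorem isPF_le {n k Δ : ℕ} {F : Fin Δ → (ZMod (2 ^ k) → ZMod 2)} (h : IsPF n k Δ F) : k ≤ n := by
  have := isPF_card h
  exact (Nat.pow_dvd_pow_iff_le_right (by norm_num)).1 (Dvd.intro_left _ this)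

end PFact

theorem stmt_5 (n k : ℕ) (hn : 0 < n) (hk : 0 < k) :
    ((∃ Δ : ℕ, 0 < Δ ∧ ∃ F : Fin Δ → (ZMod (2 ^ k) → ZMod 2), IsPF n k Δ F) ↔
      (k ≤ n ∧ n < 2 ^ k)) ∧
    (∀ (Δ : ℕ) (F : Fin Δ → (ZMod (2 ^ k) → ZMod 2)), 0 < Δ → IsPF n k Δ F →
      Δ = 2 ^ (n - k)) := by
  refine ⟨⟨?_, ?_⟩, ?_⟩
  · rintro ⟨Δ, -, F, h⟩
    exact ⟨PFact.isPF_le h, PFact.isPF_lt hk h⟩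
  · rintro ⟨h1, h2⟩
    obtain ⟨A, σ, W, h⟩ := PFact.exists_sys n k hk h1 h2
    exact h.isPF hn
  · intro Δ F _ h
    have h1 := PFact.isPF_card h
    have h2 := PFact.isPF_le h
    have h3 : 2 ^ n = 2 ^ (n - k) * 2 ^ k := by rw [← pow_add]; congr 1; omega
    rw [h3] at h1
    exact Nat.eq_of_mul_eq_mul_right (by positivity) h1
end

section
/- For all integers n and k with k < n < 2^k there exists a perfect factor PF(n, k), F : Fin 2^{n−k} → (ZMod 2^k → ZMod 2), such that no sequence F(a) is self-dual and the family is closed under complementation: for every index a there exists an index b with F(b)(i) = F(a)(i) + 1 for all i : ZMod 2^k. -/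
/-- A binary cyclic sequence is self-dual if its bitwise complement is a cyclic shift
of itself. -/
def IsSelfDual {N : ℕ} (s : ZMod N → ZMod 2) : Prop :=
  ∃ j : ZMod N, ∀ i : ZMod N, s (i + j) = s i + 1

namespace PFaux

/-- Difference operator on binary sequences. -/
def dl (s : ℕ → ZMod 2) : ℕ → ZMod 2 := fun i => s (i + 1) + s i

/-- Window of length `n` at position `i`. -/
def win (n : ℕ) (s : ℕ → ZMod 2) (i : ℕ) : Fin n → ZMod 2 := fun l => s (i + l)

/-- Sequence of partial sums. -/
def psum (s : ℕ → ZMod 2) : ℕ → ZMod 2 := fun i => ∑ m ∈ Finset.range i, s m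

/-- The shift operator. -/
def sh (s : ℕ → ZMod 2) : ℕ → ZMod 2 := fun i => s (i + 1)

/-- Sequences with constant `n`-th difference one. -/
def Lin (n : ℕ) (s : ℕ → ZMod 2) : Prop := dl^[n] s = fun _ => 1

lemma add_self2 (a : ZMod 2) : a + a = 0 := CharTwo.add_self_eq_zero a

lemma dl_psum (s : ℕ → ZMod 2) : dl (psum s) = s := by
  funext i
  simp only [dl, psum, Finset.sum_range_succ]
  rw [add_right_comm, add_self2, zero_add]

lemma sh_iter (s : ℕ → ZMod 2) (m i : ℕ) : (sh^[m] s) i = s (i + m) := by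
  induction m generalizing s i with
  | zero => rfl
  | succ m ih =>
    rw [Function.iterate_succ_apply, ih]
    simp only [sh]
    congr 1

lemma dl_sh (s : ℕ → ZMod 2) : dl (sh s) = sh (dl s) := rfl

lemma dl_pow (m : ℕ) (s : ℕ → ZMod 2) (i : ℕ) : (dl^[2 ^ m] s) i = s (i + 2 ^ m) + s i := by
  induction m generalizing s i with
  | zero => rfl
  | succ m ih =>
    rw [pow_succ, mul_two, Function.iterate_add_apply, ih, ih, ih]
    have := add_self2 (s (i + 2 ^ m))
    rw [show i + (2 ^ m + 2 ^ m) = i + 2 ^ m + 2 ^ m by ring]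
    linear_combination this

lemma dl_zero : dl (fun _ => 0) = fun _ => 0 := by
  funext i; simp [dl]

lemma dl_iter_zero (m : ℕ) : dl^[m] (fun _ => 0) = fun _ => 0 := by
  induction m with
  | zero => rfl
  | succ m ih => rw [Function.iterate_succ_apply, dl_zero, ih]

lemma dl_const (c : ZMod 2) : dl (fun _ => c) = fun _ => 0 := by
  funext i; simp [dl, add_self2]

lemma Lin.iter_gt {n : ℕ} {s : ℕ → ZMod 2} (h : Lin n s) {m : ℕ} (hm : n < m) :
    dl^[m] s = fun _ => 0 := by
  obtain ⟨d, rfl⟩ := Nat.exists_eq_add_of_lt hm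
  rw [show n + d + 1 = d + 1 + n by ring, Function.iterate_add_apply, h,
    Function.iterate_succ_apply, dl_const, dl_iter_zero]

lemma dl_add_const (s : ℕ → ZMod 2) (c : ZMod 2) : dl (fun i => s i + c) = dl s := by
  funext i
  simp only [dl]
  linear_combination add_self2 c

lemma Lin.add_const {n : ℕ} {s : ℕ → ZMod 2} (h : Lin (n + 1) s) (c : ZMod 2) :
    Lin (n + 1) (fun i => s i + c) := by
  unfold Lin at *
  rw [Function.iterate_succ_apply, dl_add_const, ← Function.iterate_succ_apply, h]

lemma Lin.lift {n : ℕ} {s r : ℕ → ZMod 2} (h : Lin n s) (hr : dl r = s) : Lin (n + 1) r := by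
  unfold Lin at *
  rw [Function.iterate_succ_apply, hr, h]

lemma Lin.sh {n : ℕ} {s : ℕ → ZMod 2} (h : Lin n s) : Lin n (sh s) := by
  have key : ∀ m (t : ℕ → ZMod 2), dl^[m] (PFaux.sh t) = PFaux.sh (dl^[m] t) := by
    intro m
    induction m with
    | zero => intro t; rfl
    | succ m ih => intro t; rw [Function.iterate_succ_apply, dl_sh, ih, Function.iterate_succ_apply]
  unfold Lin at *
  rw [key, h]
  rfl

lemma Lin.sh_iter {n : ℕ} {s : ℕ → ZMod 2} (h : Lin n s) (m : ℕ) : Lin n (PFaux.sh^[m] s) := by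
  induction m with
  | zero => exact h
  | succ m ih => rw [Function.iterate_succ_apply']; exact ih.sh

/-- A sequence with constant `n`-th difference is determined by its first `n` entries. -/
lemma Lin.ext {n : ℕ} {s t : ℕ → ZMod 2} (hs : Lin n s) (ht : Lin n t)
    (h : ∀ l < n, s l = t l) : s = t := by
  induction n generalizing s t with
  | zero =>
    unfold Lin at hs ht
    simp only [Function.iterate_zero, id] at hs ht
    rw [hs, ht]
  | succ n ih =>
    have h1 : dl s = dl t := by
      apply ih
      · unfold Lin at *; rwa [Function.iterate_succ_apply] at hs
      · unfold Lin at *; rwa [Function.iterate_succ_apply] at ht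
      · intro l hl
        simp only [dl]
        rw [h l (by omega), h (l + 1) (by omega)]
    funext i
    induction i with
    | zero => exact h 0 (by omega)
    | succ i ihi =>
      have := congrFun h1 i
      simp only [dl, ihi] at this
      exact add_right_cancel this

lemma Lin.win_eq {n : ℕ} {s t : ℕ → ZMod 2} (hs : Lin n s) (ht : Lin n t) {i j : ℕ}
    (h : win n s i = win n t j) (m : ℕ) : s (i + m) = t (j + m) := by
  have := Lin.ext (hs.sh_iter i) (ht.sh_iter j) (by
    intro l hl
    rw [PFaux.sh_iter, PFaux.sh_iter, add_comm l, add_comm l]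
    exact congrFun h ⟨l, hl⟩)
  have := congrFun this m
  rwa [PFaux.sh_iter, PFaux.sh_iter, add_comm m, add_comm m] at this

lemma Lin.period {n k : ℕ} {s : ℕ → ZMod 2} (hs : Lin n s) (hn : n < 2 ^ k) (i : ℕ) :
    s (i + 2 ^ k) = s i := by
  have h := congrFun (hs.iter_gt hn) i
  rw [dl_pow] at h
  exact CharTwo.add_eq_zero.mp h

lemma Lin.minPeriod {n k : ℕ} {s : ℕ → ZMod 2} (hs : Lin n s) (hk : 2 ^ k ≤ n)
    (hn : n < 2 ^ (k + 1)) : Function.minimalPeriod PFaux.sh s = 2 ^ (k + 1) := by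
  have : Fact (Nat.Prime 2) := ⟨Nat.prime_two⟩
  apply Function.minimalPeriod_eq_prime_pow
  · intro h
    have h0 : dl^[2 ^ k] s = fun _ => 0 := by
      funext i
      rw [dl_pow]
      have := congrFun h i
      rw [PFaux.sh_iter] at this
      rw [this, add_self2]
    obtain ⟨d, rfl⟩ := Nat.exists_eq_add_of_le hk
    unfold Lin at hs
    rw [add_comm, Function.iterate_add_apply, h0, dl_iter_zero] at hs
    exact absurd (congrFun hs 0) (by decide)
  · funext i
    rw [PFaux.sh_iter]
    exact hs.period hn i

lemma per_mul {s : ℕ → ZMod 2} {N : ℕ} (h : ∀ i, s (i + N) = s i) (i m : ℕ) :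
    s (i + N * m) = s i := by
  induction m with
  | zero => rfl
  | succ m ih => rw [Nat.mul_succ, ← add_assoc, h, ih]

lemma per_mod {s : ℕ → ZMod 2} {N : ℕ} (h : ∀ i, s (i + N) = s i) (i : ℕ) :
    s (i % N) = s i := by
  conv_rhs => rw [← Nat.mod_add_div i N, per_mul h]

lemma Lin.dvd_sub {n k : ℕ} {s : ℕ → ZMod 2} (hs : Lin n s) (hk : 2 ^ k ≤ n)
    (hn : n < 2 ^ (k + 1)) {i j : ℕ} (hij : i ≤ j) (h : ∀ m, s (i + m) = s (j + m)) :
    2 ^ (k + 1) ∣ j - i := by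
  rw [← hs.minPeriod hk hn]
  apply Function.IsPeriodicPt.minimalPeriod_dvd
  funext m
  rw [PFaux.sh_iter]
  have hp := hs.period hn
  obtain ⟨d, rfl⟩ := Nat.exists_eq_add_of_le hij
  have e : i ≤ 2 ^ (k + 1) * i := Nat.le_mul_of_pos_left _ (by positivity)
  obtain ⟨q, hq⟩ := Nat.exists_eq_add_of_le e
  have := h (m + q)
  rw [show i + (m + q) = m + 2 ^ (k + 1) * i by omega, per_mul hp,
    show i + d + (m + q) = m + d + 2 ^ (k + 1) * i by omega, per_mul hp] at this
  rw [this]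
  congr 1
  omega

lemma Lin.modEq {n k : ℕ} {s : ℕ → ZMod 2} (hs : Lin n s) (hk : 2 ^ k ≤ n)
    (hn : n < 2 ^ (k + 1)) {i j : ℕ} (h : ∀ m, s (i + m) = s (j + m)) :
    i ≡ j [MOD 2 ^ (k + 1)] := by
  rcases le_total i j with hij | hij
  · exact (Nat.modEq_iff_dvd' hij).mpr (hs.dvd_sub hk hn hij h)
  · exact ((Nat.modEq_iff_dvd' hij).mpr (hs.dvd_sub hk hn hij (fun m => (h m).symm))).symm

lemma win_mod {s : ℕ → ZMod 2} {N : ℕ} (h : ∀ i, s (i + N) = s i) (n i : ℕ) :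
    win n s (i % N) = win n s i := by
  funext l
  simp only [win]
  rw [← per_mod h, Nat.mod_add_mod, per_mod h]

/-- `s` is a cyclic sequence of period `N` whose windows enumerate `A`. -/
structure IsCyc (n N : ℕ) (A : Set (Fin n → ZMod 2)) (p : ZMod 2) (s : ℕ → ZMod 2) : Prop where
  per : ∀ i, s (i + N) = s i
  mem : ∀ i, win n s i ∈ A
  inj : ∀ i < N, ∀ j < N, win n s i = win n s j → i = j
  sur : ∀ x ∈ A, ∃ i < N, win n s i = x
  sum : ∑ i ∈ Finset.range N, s i = p

lemma sum_eq_psum (s : ℕ → ZMod 2) (N : ℕ) : ∑ i ∈ Finset.range N, s i = psum s N := rfl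

lemma Lin.isCyc {n k : ℕ} {s : ℕ → ZMod 2} (hs : Lin n s) (hk : 2 ^ k ≤ n)
    (hn : n < 2 ^ (k + 1)) :
    IsCyc n (2 ^ (k + 1)) (Set.range (win n s)) (if n + 1 = 2 ^ (k + 1) then 1 else 0) s where
  per := hs.period hn
  mem i := ⟨i, rfl⟩
  inj i hi j hj h := by
    have := hs.modEq hk hn (hs.win_eq hs h)
    exact Nat.ModEq.eq_of_lt_of_lt this hi hj
  sur := by
    rintro x ⟨i, rfl⟩
    exact ⟨i % 2 ^ (k + 1), Nat.mod_lt _ (by positivity), win_mod (hs.period hn) n i⟩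
  sum := by
    have h1 := dl_pow (k + 1) (psum s) 0
    rw [zero_add, show psum s 0 = 0 by simp [psum], add_zero] at h1
    rw [sum_eq_psum, ← h1]
    have h2 : Lin (n + 1) (psum s) := hs.lift (dl_psum s)
    split_ifs with h
    · rw [← h, h2]
    · rw [h2.iter_gt (by omega)]

lemma IsCyc.shift1 {n N : ℕ} {A : Set (Fin n → ZMod 2)} {p : ZMod 2} {s : ℕ → ZMod 2}
    (h : IsCyc n N A p s) : IsCyc n N A p (sh s) := by
  have hw : ∀ i, win n (sh s) i = win n s (i + 1) := by
    intro i; funext l; simp only [win, sh]; congr 1; omega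
  refine ⟨fun i => ?_, fun i => ?_, ?_, ?_, ?_⟩
  · simp only [sh]; rw [← h.per (i + 1)]; congr 1; omega
  · rw [hw]; exact h.mem _
  · intro i hi j hj hij
    rw [hw, hw, ← win_mod h.per, ← win_mod h.per n (j + 1)] at hij
    have := h.inj _ (Nat.mod_lt _ (by omega)) _ (Nat.mod_lt _ (by omega)) hij
    exact Nat.ModEq.eq_of_lt_of_lt (Nat.ModEq.add_right_cancel' 1 this) hi hj
  · intro x hx
    obtain ⟨i, hi, rfl⟩ := h.sur x hx
    refine ⟨(i + (N - 1)) % N, Nat.mod_lt _ (by omega), ?_⟩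
    rw [hw, ← win_mod h.per, Nat.mod_add_mod, win_mod h.per,
      show i + (N - 1) + 1 = i + N by omega, ← win_mod h.per, Nat.add_mod_right, win_mod h.per]
  · rw [← h.sum]
    simp only [sh]
    have a := Finset.sum_range_succ s N
    rw [Finset.sum_range_succ', ← zero_add N, h.per, zero_add] at a
    exact add_right_cancel a

lemma IsCyc.shift {n N : ℕ} {A : Set (Fin n → ZMod 2)} {p : ZMod 2} {s : ℕ → ZMod 2}
    (h : IsCyc n N A p s) (m : ℕ) : IsCyc n N A p (sh^[m] s) := by
  induction m with
  | zero => exact h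
  | succ m ih => rw [Function.iterate_succ_apply']; exact ih.shift1

lemma IsCyc.start {n N : ℕ} {A : Set (Fin n → ZMod 2)} {p : ZMod 2} {s : ℕ → ZMod 2}
    (h : IsCyc n N A p s) {a : Fin n → ZMod 2} (ha : a ∈ A) :
    ∃ t, IsCyc n N A p t ∧ win n t 0 = a := by
  obtain ⟨i, hi, rfl⟩ := h.sur a ha
  refine ⟨_, h.shift i, ?_⟩
  funext l
  simp only [win, sh_iter]
  congr 1; omega

/-- Joining two cycles at a pair of conjugate windows. -/
lemma IsCyc.join {n N : ℕ} {A B : Set (Fin n → ZMod 2)} {p q : ZMod 2} {s t : ℕ → ZMod 2}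
    (hs : IsCyc n N A p s) (ht : IsCyc n N B q t) (hn : n < N) (hAB : Disjoint A B)
    {a b : Fin n → ZMod 2} (ha : a ∈ A) (hb : b ∈ B)
    (hab : ∀ l : Fin n, (l : ℕ) + 1 < n → a l = b l) :
    ∃ u, IsCyc n (2 * N) (A ∪ B) (p + q) u := by
  obtain ⟨s, hs, rfl⟩ := hs.start ha
  obtain ⟨t, ht, rfl⟩ := ht.start hb
  have hst : ∀ l, l + 1 < n → s l = t l := by
    intro l hl
    have := hab ⟨l, by omega⟩ hl
    simpa [win] using this
  set c : ℕ → ZMod 2 := fun m => if m % (2 * N) < N then s m else t m with hc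
  have cper : ∀ i, c (i + 2 * N) = c i := by
    intro i
    simp only [hc, Nat.add_mod_right]
    rw [mul_comm 2 N, per_mul hs.per, per_mul ht.per]
  have w1 : ∀ i < N, win n c i = win n s i := by
    intro i hi
    funext l
    have hl := l.2
    simp only [win, hc]
    rw [Nat.mod_eq_of_lt (by omega)]
    split_ifs with h
    · rfl
    · obtain ⟨d, hd⟩ := Nat.exists_eq_add_of_le (not_lt.mp h)
      rw [hd, add_comm N d, hs.per, ht.per, hst _ (by omega)]
  have w2 : ∀ i < N, win n c (i + N) = win n t i := by
    intro i hi
    funext l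
    have hl := l.2
    simp only [win, hc]
    by_cases h : i + l < N
    · rw [Nat.mod_eq_of_lt (by omega), if_neg (by omega), ← ht.per (i + l)]
      congr 1; omega
    · obtain ⟨d, hd⟩ := Nat.exists_eq_add_of_le (not_lt.mp h)
      rw [show i + N + l = d + 2 * N by omega, Nat.add_mod_right, Nat.mod_eq_of_lt (by omega),
        if_pos (by omega), mul_comm 2 N, per_mul hs.per, hd, add_comm N d, ht.per,
        hst _ (by omega)]
  have dis : ∀ i j, win n s i ≠ win n t j := fun i j h =>
    Set.disjoint_left.mp hAB (hs.mem i) (h ▸ ht.mem j)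
  refine ⟨c, cper, ?_, ?_, ?_, ?_⟩
  · intro i
    rw [← win_mod cper]
    have := Nat.mod_lt i (show 2 * N > 0 by omega)
    by_cases h : i % (2 * N) < N
    · rw [w1 _ h]; exact Or.inl (hs.mem _)
    · obtain ⟨d, hd⟩ := Nat.exists_eq_add_of_le (not_lt.mp h)
      rw [hd, add_comm, w2 _ (by omega)]; exact Or.inr (ht.mem _)
  · intro i hi j hj hij
    by_cases h : i < N <;> by_cases h' : j < N
    · rw [w1 _ h, w1 _ h'] at hij; exact hs.inj i h j h' hij
    · obtain ⟨d, rfl⟩ := Nat.exists_eq_add_of_le (not_lt.mp h')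
      rw [w1 _ h, add_comm, w2 _ (by omega)] at hij
      exact absurd hij (dis _ _)
    · obtain ⟨d, rfl⟩ := Nat.exists_eq_add_of_le (not_lt.mp h)
      rw [w1 _ h', add_comm, w2 _ (by omega)] at hij
      exact absurd hij.symm (dis _ _)
    · obtain ⟨d, rfl⟩ := Nat.exists_eq_add_of_le (not_lt.mp h)
      obtain ⟨e, rfl⟩ := Nat.exists_eq_add_of_le (not_lt.mp h')
      rw [add_comm, w2 _ (by omega), add_comm, w2 _ (by omega)] at hij
      rw [ht.inj d (by omega) e (by omega) hij]
  · rintro x (hx | hx)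
    · obtain ⟨i, hi, rfl⟩ := hs.sur x hx
      exact ⟨i, by omega, w1 i hi⟩
    · obtain ⟨i, hi, rfl⟩ := ht.sur x hx
      exact ⟨i + N, by omega, w2 i hi⟩
  · rw [two_mul, Finset.sum_range_add, ← hs.sum, ← ht.sum]
    congr 1
    · apply Finset.sum_congr rfl
      intro i hi
      have := Finset.mem_range.mp hi
      simp only [hc]
      rw [Nat.mod_eq_of_lt (by omega), if_pos this]
    · apply Finset.sum_congr rfl
      intro i hi
      have := Finset.mem_range.mp hi
      simp only [hc]
      rw [Nat.mod_eq_of_lt (by omega), if_neg (by omega), add_comm, ht.per]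

/-- Difference operator on tuples. -/
def dt {n : ℕ} (y : Fin (n + 1) → ZMod 2) : Fin n → ZMod 2 := fun l => y l.succ + y l.castSucc

/-- Complement of a set of tuples (bitwise). -/
def co {n : ℕ} (A : Set (Fin n → ZMod 2)) : Set (Fin n → ZMod 2) :=
  {y | (fun l => y l + 1) ∈ A}

/-- Hierarchical joining of the cycles of the register `Lin n`. -/
inductive Tree (n k : ℕ) : ℕ → Set (Fin n → ZMod 2) → Prop
  | base (s : ℕ → ZMod 2) (hs : Lin n s) : Tree n k k (Set.range (win n s))
  | join {j : ℕ} {A B : Set (Fin n → ZMod 2)} (hA : Tree n k j A) (hB : Tree n k j B)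
      (hAB : Disjoint A B) (a b : Fin n → ZMod 2) (ha : a ∈ A) (hb : b ∈ B)
      (hab : ∀ l : Fin n, (l : ℕ) + 1 < n → a l = b l) : Tree n k (j + 1) (A ∪ B)

lemma Tree.le {n k j : ℕ} {A : Set (Fin n → ZMod 2)} (h : Tree n k j A) : k ≤ j := by
  induction h with
  | base => exact le_rfl
  | join => omega

lemma Tree.nonempty {n k j : ℕ} {A : Set (Fin n → ZMod 2)} (h : Tree n k j A) : A.Nonempty := by
  induction h with
  | base s hs => exact ⟨_, 0, rfl⟩
  | join _ _ _ a b ha => exact ⟨a, Or.inl ha⟩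

lemma Tree.isCyc {n k j : ℕ} {A : Set (Fin n → ZMod 2)} (h : Tree n (k + 1) j A)
    (hk : 2 ^ k ≤ n) (hn : n < 2 ^ (k + 1)) :
    ∃ s, IsCyc n (2 ^ j) A (if j = k + 1 ∧ n + 1 = 2 ^ (k + 1) then 1 else 0) s := by
  induction h with
  | base s hs =>
    refine ⟨s, ?_⟩
    have := hs.isCyc hk hn
    simpa using this
  | @join j A B hA hB hAB a b ha hb hab ihA ihB =>
    obtain ⟨s, hs⟩ := ihA
    obtain ⟨t, ht⟩ := ihB
    have hle := hA.le
    obtain ⟨u, hu⟩ := hs.join ht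
      (hn.trans_le (Nat.pow_le_pow_right (by norm_num) hle)) hAB ha hb hab
    refine ⟨u, ?_⟩
    rw [add_self2] at hu
    rw [if_neg (by omega), pow_succ, mul_comm]
    exact hu

lemma Tree.refine {n k j : ℕ} {A : Set (Fin n → ZMod 2)} (h : Tree n k j A) (i : ℕ)
    (hi : k ≤ i) (hij : i ≤ j) :
    ∃ (ι : Type) (_ : Fintype ι) (F : ι → Set (Fin n → ZMod 2)),
      Fintype.card ι = 2 ^ (j - i) ∧ (∀ a, Tree n k i (F a)) ∧
      (∀ a, F a ⊆ A) ∧ ∀ x ∈ A, ∃! a, x ∈ F a := by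
  induction h with
  | base s hs =>
    obtain rfl : k = i := le_antisymm hi hij
    exact ⟨Unit, inferInstance, fun _ => Set.range (win n s), by simp, fun _ => .base s hs,
      fun _ => subset_rfl, fun x hx => ⟨(), hx, fun _ _ => rfl⟩⟩
  | @join j A B hA hB hAB a b ha hb hab ihA ihB =>
    rcases Nat.lt_or_ge j i with hji | hji
    · obtain rfl : i = j + 1 := by omega
      exact ⟨Unit, inferInstance, fun _ => A ∪ B, by simp, fun _ => .join hA hB hAB a b ha hb hab,
        fun _ => subset_rfl, fun x hx => ⟨(), hx, fun _ _ => rfl⟩⟩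
    · obtain ⟨ι, _, F, c1, t1, s1, u1⟩ := ihA hji
      obtain ⟨κ, _, G, c2, t2, s2, u2⟩ := ihB hji
      refine ⟨ι ⊕ κ, inferInstance, Sum.elim F G, ?_, ?_, ?_, ?_⟩
      · rw [Fintype.card_sum, c1, c2, Nat.sub_add_comm hji, pow_succ, mul_two]
      · rintro (a | a)
        · exact t1 a
        · exact t2 a
      · rintro (a | a)
        · exact (s1 a).trans Set.subset_union_left
        · exact (s2 a).trans Set.subset_union_right
      · rintro x (hx | hx)
        · obtain ⟨a, ha, hu⟩ := u1 x hx
          refine ⟨.inl a, ha, ?_⟩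
          rintro (b | b) hb
          · rw [hu b hb]
          · exact absurd (s2 b hb) (Set.disjoint_left.mp hAB hx)
        · obtain ⟨a, ha, hu⟩ := u2 x hx
          refine ⟨.inr a, ha, ?_⟩
          rintro (b | b) hb
          · exact absurd hx (Set.disjoint_left.mp hAB (s1 b hb))
          · rw [hu b hb]

lemma dt_win (n : ℕ) (r : ℕ → ZMod 2) (i : ℕ) : dt (win (n + 1) r i) = win n (dl r) i := rfl

lemma dt_eq {n : ℕ} {x y : Fin (n + 1) → ZMod 2} (h : dt x = dt y) (h0 : x 0 = y 0) : x = y := by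
  funext l
  induction l using Fin.induction with
  | zero => exact h0
  | succ l ih =>
    have := congrFun h l
    simp only [dt, ih] at this
    exact add_right_cancel this

lemma two_cases (a : ZMod 2) : a = 0 ∨ a = 1 := by
  revert a; decide

lemma dt_eq' {n : ℕ} {x y : Fin (n + 1) → ZMod 2} (h : dt x = dt y) :
    ∀ l, x l = y l + (x 0 + y 0) := by
  have : x = fun l => y l + (x 0 + y 0) := by
    apply dt_eq
    · rw [h]; funext l; simp only [dt]; linear_combination - add_self2 (x 0 + y 0)
    · linear_combination - add_self2 (y 0)
  exact congrFun this

/-- A canonical preimage of a tuple. -/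
def up {n : ℕ} (a : Fin n → ZMod 2) : Fin (n + 1) → ZMod 2 :=
  fun l => psum (fun m => if h : m < n then a ⟨m, h⟩ else 0) l

lemma dt_up {n : ℕ} (a : Fin n → ZMod 2) : dt (up a) = a := by
  funext l
  simp only [dt, up]
  have := congrFun (dl_psum (fun m => if h : m < n then a ⟨m, h⟩ else 0)) l
  simpa [dl] using this

lemma up_congr {n : ℕ} {a b : Fin n → ZMod 2} (hab : ∀ l : Fin n, (l : ℕ) + 1 < n → a l = b l)
    (l : Fin (n + 1)) (hl : (l : ℕ) + 1 < n + 1) : up a l = up b l := by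
  simp only [up, psum]
  apply Finset.sum_congr rfl
  intro m hm
  have := Finset.mem_range.mp hm
  rw [dif_pos (by omega), dif_pos (by omega)]
  exact hab _ (by simp; omega)

lemma Tree.liftOdd {n k j : ℕ} {A : Set (Fin n → ZMod 2)} (h : Tree n (k + 1) j A)
    (hn : n + 1 = 2 ^ (k + 1)) : Tree (n + 1) (k + 2) (j + 1) (dt ⁻¹' A) := by
  induction h with
  | base s hs =>
    have hr := hs.lift (dl_psum s)
    have := Tree.base (k := k + 2) _ hr
    convert this using 1
    ext y
    constructor
    · rintro ⟨i, hi⟩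
      have hy : dt y = dt (win (n + 1) (psum s) i) := by rw [dt_win, dl_psum, hi]
      have hy' := dt_eq' hy
      rcases two_cases (y 0 + win (n + 1) (psum s) i 0) with h0 | h0
      · refine ⟨i, ?_⟩
        funext l; rw [hy' l, h0, add_zero]
      · refine ⟨i + 2 ^ (k + 1), ?_⟩
        funext l
        rw [hy' l, h0]
        have h1 : (dl^[2 ^ (k + 1)] (psum s)) (i + l) = 1 := by rw [← hn, hr]
        rw [dl_pow] at h1
        simp only [win]
        rw [show i + 2 ^ (k + 1) + (l : ℕ) = i + l + 2 ^ (k + 1) by ring]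
        linear_combination h1 - add_self2 (psum s (i + l))
    · rintro ⟨i, rfl⟩
      exact ⟨i, by rw [dt_win, dl_psum]⟩
  | @join j A B hA hB hAB a b ha hb hab ihA ihB =>
    rw [Set.preimage_union]
    refine .join ihA ihB (hAB.preimage _) (up a) (up b) ?_ ?_ (up_congr hab)
    · rwa [Set.mem_preimage, dt_up]
    · rwa [Set.mem_preimage, dt_up]

lemma co_co {n : ℕ} (A : Set (Fin n → ZMod 2)) : co (co A) = A := by
  ext y
  simp only [co, Set.mem_ofPred_eq, add_assoc, add_self2, add_zero]

lemma co_union {n : ℕ} (A B : Set (Fin n → ZMod 2)) : co (A ∪ B) = co A ∪ co B := rfl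

/-- Lifting property at even weight. -/
def LiftE {n : ℕ} (k j : ℕ) (A : Set (Fin n → ZMod 2)) (A' : Set (Fin (n + 1) → ZMod 2)) : Prop :=
  Tree (n + 1) k j A' ∧ Tree (n + 1) k j (co A') ∧ Disjoint A' (co A') ∧ dt ⁻¹' A = A' ∪ co A'

lemma LiftE.co {n k j : ℕ} {A : Set (Fin n → ZMod 2)} {A' : Set (Fin (n + 1) → ZMod 2)}
    (h : LiftE k j A A') : LiftE k j A (co A') := by
  obtain ⟨h1, h2, h3, h4⟩ := h
  refine ⟨h2, ?_, ?_, ?_⟩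
  · rwa [co_co]
  · rw [co_co]; exact h3.symm
  · rw [co_co, h4, Set.union_comm]

lemma LiftE.choose {n k j : ℕ} {A : Set (Fin n → ZMod 2)} {A' : Set (Fin (n + 1) → ZMod 2)}
    (h : LiftE k j A A') {a : Fin (n + 1) → ZMod 2} (ha : dt a ∈ A) :
    ∃ A'', LiftE k j A A'' ∧ a ∈ A'' := by
  have : a ∈ A' ∪ PFaux.co A' := h.2.2.2 ▸ (show a ∈ dt ⁻¹' A from ha)
  rcases this with h' | h'
  · exact ⟨_, h, h'⟩
  · exact ⟨_, h.co, h'⟩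

lemma Tree.liftEven {n k j : ℕ} {A : Set (Fin n → ZMod 2)} (h : Tree n (k + 1) j A)
    (hk : 2 ^ k ≤ n) (hn : n + 1 < 2 ^ (k + 1)) : ∃ A', LiftE (k + 1) j A A' := by
  induction h with
  | base s hs =>
    have hr := hs.lift (dl_psum s)
    have hco : co (Set.range (win (n + 1) (psum s))) =
        Set.range (win (n + 1) (fun i => psum s i + 1)) := by
      ext y
      constructor
      · rintro ⟨i, hi⟩
        refine ⟨i, ?_⟩
        funext l
        have := congrFun hi l
        simp only [win] at this ⊢
        rw [this, add_assoc, add_self2, add_zero]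
      · rintro ⟨i, rfl⟩
        refine ⟨i, ?_⟩
        funext l
        simp only [win]
        rw [add_assoc, add_self2, add_zero]
    refine ⟨Set.range (win (n + 1) (psum s)), .base _ hr, ?_, ?_, ?_⟩
    · rw [hco]
      exact .base _ (hr.add_const 1)
    · rw [hco, Set.disjoint_left]
      rintro _ ⟨i, rfl⟩ ⟨j, hj⟩
      have h1 := hr.win_eq (hr.add_const 1) hj.symm
      have h2 : ∀ m, s (i + m) = s (j + m) := by
        intro m
        have a1 := h1 m
        have a2 := h1 (m + 1)
        rw [← dl_psum s]
        simp only [dl]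
        rw [add_assoc i, add_assoc j, a1, a2]
        linear_combination add_self2 (1 : ZMod 2)
      have h3 := hs.modEq hk (by omega) h2
      have h4 : psum s i = psum s j := by
        rw [← per_mod (hr.period hn) i, ← per_mod (hr.period hn) j, h3]
      have h5 := h1 0
      simp only [add_zero] at h5
      rw [h4] at h5
      simp at h5
    · rw [hco]
      ext y
      constructor
      · rintro ⟨i, hi⟩
        have hy : dt y = dt (win (n + 1) (psum s) i) := by rw [dt_win, dl_psum, hi]
        have hy' := dt_eq' hy
        rcases two_cases (y 0 + win (n + 1) (psum s) i 0) with h0 | h0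
        · refine Or.inl ⟨i, ?_⟩
          funext l; rw [hy' l, h0, add_zero]
        · refine Or.inr ⟨i, ?_⟩
          funext l; rw [hy' l, h0]; rfl
      · rintro (⟨i, rfl⟩ | ⟨i, rfl⟩)
        · exact ⟨i, by rw [dt_win, dl_psum]⟩
        · exact ⟨i, by rw [dt_win, dl_add_const, dl_psum]⟩
  | @join j A B hA hB hAB a b ha hb hab ihA ihB =>
    obtain ⟨A', hA'⟩ := ihA
    obtain ⟨B', hB'⟩ := ihB
    obtain ⟨A', hA', ha'⟩ := hA'.choose (a := up a) (by rwa [dt_up])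
    obtain ⟨B', hB', hb'⟩ := hB'.choose (a := up b) (by rwa [dt_up])
    obtain ⟨a1, a2, a3, a4⟩ := hA'
    obtain ⟨b1, b2, b3, b4⟩ := hB'
    have hd : Disjoint (A' ∪ co A') (B' ∪ co B') := by
      rw [← a4, ← b4]; exact hAB.preimage _
    rw [Set.disjoint_union_left, Set.disjoint_union_right, Set.disjoint_union_right] at hd
    obtain ⟨⟨d1, d2⟩, d3, d4⟩ := hd
    have e : ∀ {A : Set (Fin (n + 1) → ZMod 2)} {y : Fin (n + 1) → ZMod 2}, y ∈ A →
        (fun l => y l + 1) ∈ co A := by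
      intro A y hy
      rw [← co_co A] at hy
      exact hy
    refine ⟨A' ∪ B', ?_, ?_, ?_, ?_⟩
    · exact .join a1 b1 d1 _ _ ha' hb' (up_congr hab)
    · rw [co_union]
      exact .join a2 b2 d4 _ _ (e ha') (e hb') (fun l hl => by rw [up_congr hab l hl])
    · rw [co_union, Set.disjoint_union_left, Set.disjoint_union_right, Set.disjoint_union_right]
      exact ⟨⟨a3, d2⟩, d3.symm, b3⟩
    · rw [Set.preimage_union, a4, b4, co_union, Set.union_union_union_comm]

/-- Each member of a node has a successor in it. -/
lemma Tree.succ {n k j : ℕ} {A : Set (Fin (n + 1) → ZMod 2)} (h : Tree (n + 1) k j A) :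
    ∀ x ∈ A, ∃ y ∈ A, ∀ l : Fin n, y l.castSucc = x l.succ := by
  induction h with
  | base s hs =>
    rintro _ ⟨i, rfl⟩
    refine ⟨_, ⟨i + 1, rfl⟩, ?_⟩
    intro l
    simp only [win, Fin.val_castSucc, Fin.val_succ]
    congr 1; ring
  | join hA hB hAB a b ha hb hab ihA ihB =>
    rintro x (hx | hx)
    · obtain ⟨y, hy, h⟩ := ihA x hx
      exact ⟨y, Or.inl hy, h⟩
    · obtain ⟨y, hy, h⟩ := ihB x hx
      exact ⟨y, Or.inr hy, h⟩

lemma Tree.connected {n k j : ℕ} {A B : Set (Fin (n + 1) → ZMod 2)} (hA : Tree (n + 1) k j A)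
    (hB : B.Nonempty) (hAB : Disjoint A B) (hU : A ∪ B = Set.univ) :
    ∃ a ∈ A, ∃ b ∈ B, ∀ l : Fin (n + 1), (l : ℕ) + 1 < n + 1 → a l = b l := by
  by_contra! hcon
  have hcl : ∀ a ∈ A, ∀ b : Fin (n + 1) → ZMod 2,
      (∀ l : Fin (n + 1), (l : ℕ) + 1 < n + 1 → a l = b l) → b ∈ A := by
    intro a ha b hab
    by_contra hb
    have hbB : b ∈ B := by
      have : b ∈ A ∪ B := hU ▸ Set.mem_univ b
      exact this.resolve_left hb
    obtain ⟨l, hl, hne⟩ := hcon a ha b hbB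
    exact hne (hab l hl)
  obtain ⟨y, hy⟩ := hB
  have key : ∀ m ≤ n + 1, ∃ z ∈ A, ∀ l (hl : l < m) (h1 : n + 1 - m + l < n + 1) (h2 : l < n + 1),
      z ⟨n + 1 - m + l, h1⟩ = y ⟨l, h2⟩ := by
    intro m
    induction m with
    | zero =>
      intro _
      obtain ⟨z, hz⟩ := hA.nonempty
      exact ⟨z, hz, fun l hl => absurd hl (by omega)⟩
    | succ m ih =>
      intro hm
      obtain ⟨z, hz, hzy⟩ := ih (by omega)
      obtain ⟨w, hw, hwz⟩ := hA.succ z hz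
      refine ⟨fun l => if (l : ℕ) = n then y ⟨m, by omega⟩ else w l, hcl w hw _ ?_, ?_⟩
      · intro l hl
        rw [if_neg (by omega)]
      · intro l hl h1 h2
        beta_reduce
        by_cases hlm : l = m
        · subst hlm
          rw [if_pos (by simp; omega)]
        · rw [if_neg (by simp; omega)]
          have e1 := hwz ⟨n + 1 - (m + 1) + l, by omega⟩
          have e2 := hzy l (by omega) (by omega) h2
          rw [← e2]
          have e3 : (⟨n + 1 - m + l, by omega⟩ : Fin (n + 1)) =
              Fin.succ ⟨n + 1 - (m + 1) + l, by omega⟩ :=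
            Fin.ext (by simp only [Fin.val_succ]; omega)
          rw [e3]
          exact e1
  obtain ⟨z, hz, hzy⟩ := key (n + 1) le_rfl
  have : z = y := by
    funext l
    have := hzy l l.2 (by omega) l.2
    convert this using 2
    simp
  exact Set.disjoint_left.mp hAB hz (this ▸ hy)

lemma tree_univ (n : ℕ) (hn : 1 ≤ n) :
    ∃ k, 2 ^ k ≤ n ∧ n < 2 ^ (k + 1) ∧ Tree n (k + 1) n Set.univ := by
  induction n, hn using Nat.le_induction with
  | base =>
    refine ⟨0, by norm_num, by norm_num, ?_⟩
    have h : Lin 1 (fun i => (i : ZMod 2)) := by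
      unfold Lin
      funext i
      simp only [Function.iterate_one, dl]
      push_cast
      linear_combination add_self2 (i : ZMod 2)
    convert Tree.base (k := 1) _ h using 1
    symm
    rw [Set.eq_univ_iff_forall]
    intro y
    rcases two_cases (y 0) with h0 | h0
    · refine ⟨0, ?_⟩
      funext l
      rw [Subsingleton.elim l 0, h0]
      simp [win]
    · refine ⟨1, ?_⟩
      funext l
      rw [Subsingleton.elim l 0, h0]
      simp [win]
  | succ n hn1 ih =>
    obtain ⟨k, hk, hn, hT⟩ := ih
    rcases Nat.lt_or_ge (n + 1) (2 ^ (k + 1)) with h | h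
    · refine ⟨k, by omega, h, ?_⟩
      obtain ⟨A', h1, h2, h3, h4⟩ := hT.liftEven hk h
      rw [Set.preimage_univ] at h4
      obtain ⟨a, ha, b, hb, hab⟩ := h1.connected h2.nonempty h3 h4.symm
      rw [h4]
      exact .join h1 h2 h3 a b ha hb hab
    · have h' : n + 1 = 2 ^ (k + 1) := by omega
      refine ⟨k + 1, h, by rw [pow_succ]; omega, ?_⟩
      exact hT.liftOdd h'

end PFaux

open PFaux in
theorem stmt_6 (n k : ℕ) (hkn : k < n) (hn : n < 2 ^ k) :
    ∃ F : Fin (2 ^ (n - k)) → (ZMod (2 ^ k) → ZMod 2),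
      IsPF n k (2 ^ (n - k)) F ∧
      (∀ a, ¬ IsSelfDual (F a)) ∧
      (∀ a, ∃ b, ∀ i : ZMod (2 ^ k), F b i = F a i + 1) := by
  obtain ⟨n, rfl⟩ : ∃ m, n = m + 1 := ⟨n - 1, by omega⟩
  have hn1 : 1 ≤ n := by
    by_contra h
    obtain rfl : n = 0 := by omega
    obtain rfl : k = 0 := by omega
    simp at hn
  obtain ⟨q, hq1, hq2, hT⟩ := tree_univ n hn1
  have hqk : q + 1 ≤ k := by
    have : 2 ^ q < 2 ^ k := by omega
    have := (Nat.pow_lt_pow_iff_right (by norm_num)).mp this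
    omega
  obtain ⟨ι, _, G, hcard, hG, -, huniq⟩ := hT.refine k hqk (by omega)
  have hcyc : ∀ a, ∃ s, IsCyc n (2 ^ k) (G a) 0 s := by
    intro a
    obtain ⟨s, hs⟩ := (hG a).isCyc hq1 hq2
    rw [if_neg (by rintro ⟨rfl, h⟩; omega)] at hs
    exact ⟨s, hs⟩
  choose S hS using hcyc
  have hper : ∀ a i, psum (S a) (i + 2 ^ k) = psum (S a) i := by
    intro a i
    have h : ∀ N, psum (S a) (i + N) = psum (S a) i + psum (sh^[i] (S a)) N := by
      intro N
      simp only [psum, Finset.sum_range_add, sh_iter]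
      congr 1
      exact Finset.sum_congr rfl fun x _ => by rw [add_comm]
    rw [h, ← sum_eq_psum (sh^[i] (S a)), ((hS a).shift i).sum, add_zero]
  have hc2 : Fintype.card (ι × ZMod 2) = Fintype.card (Fin (2 ^ (n + 1 - k))) := by
    rw [Fintype.card_prod, hcard, ZMod.card, Fintype.card_fin, Nat.sub_add_comm (by omega), pow_succ]
  let e : ι × ZMod 2 ≃ Fin (2 ^ (n + 1 - k)) := Fintype.equivOfCardEq hc2
  have : NeZero (2 ^ k) := ⟨by positivity⟩
  let F : Fin (2 ^ (n + 1 - k)) → (ZMod (2 ^ k) → ZMod 2) := fun a x =>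
    psum (S (e.symm a).1) x.val + (e.symm a).2
  have hF : ∀ a (j : ZMod (2 ^ k)) (m : ℕ),
      F a (j + (m : ℕ)) = psum (S (e.symm a).1) (j.val + m) + (e.symm a).2 := by
    intro a j m
    simp only [F]
    rw [ZMod.val_add, ZMod.val_natCast, Nat.add_mod_mod, per_mod (hper _)]
  have hPF : IsPF (n + 1) k (2 ^ (n + 1 - k)) F := by
    intro x
    obtain ⟨a, ha, hu⟩ := huniq (dt x) (Set.mem_univ _)
    obtain ⟨j, hj, hjx⟩ := (hS a).sur _ ha
    have hy : dt x = dt (win (n + 1) (psum (S a)) j) := by rw [dt_win, dl_psum, hjx]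
    have hy' := dt_eq' hy
    refine ⟨(e (a, x 0 + win (n + 1) (psum (S a)) j 0), (j : ZMod (2 ^ k))), ?_, ?_⟩
    · intro i
      simp only [hF, Equiv.symm_apply_apply]
      rw [ZMod.val_natCast, Nat.mod_eq_of_lt hj, hy' i]
      rfl
    · rintro ⟨b, j'⟩ hb
      obtain ⟨⟨b, c⟩, rfl⟩ := e.surjective b
      simp only [hF, Equiv.symm_apply_apply] at hb
      have hx : x = win (n + 1) (fun i => psum (S b) i + c) j'.val := by
        funext i; exact (hb i).symm
      have hdx : dt x = win n (S b) j'.val := by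
        rw [hx, dt_win, dl_add_const, dl_psum]
      obtain rfl : b = a := hu b (hdx ▸ (hS b).mem _)
      have hjj : j'.val = j := (hS b).inj _ (ZMod.val_lt j') _ hj (by rw [← hdx, hjx])
      have hj2 : j' = (j : ZMod (2 ^ k)) := by rw [← hjj, ZMod.natCast_zmod_val]
      have hc : c = x 0 + win (n + 1) (psum (S b)) j 0 := by
        have h0 := hb 0
        rw [← h0, hjj]
        simp only [win]
        linear_combination - add_self2 (psum (S b) (j + ((0 : Fin (n + 1)) : ℕ)))
      rw [hj2, ← hc]
  have hcomp : ∀ a, ∃ b, b ≠ a ∧ ∀ i : ZMod (2 ^ k), F b i = F a i + 1 := by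
    intro a
    obtain ⟨⟨a, c⟩, rfl⟩ := e.surjective a
    refine ⟨e (a, c + 1), ?_, ?_⟩
    · intro h
      have := congrArg Prod.snd (e.injective h)
      simp at this
    · intro i
      simp only [F, Equiv.symm_apply_apply, add_assoc]
  refine ⟨F, hPF, ?_, fun a => ?_⟩
  · rintro a ⟨j, hj⟩
    obtain ⟨b, hba, hb⟩ := hcomp a
    obtain ⟨p, -, hp⟩ := hPF (fun i => F b (0 + ((i : ℕ) : ZMod (2 ^ k))))
    have h1 := hp (b, 0) (fun i => rfl)
    have h2 := hp (a, j) (fun i => by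
      simp only [hb, zero_add]
      rw [← hj, add_comm])
    exact hba (congrArg Prod.fst (h1.trans h2.symm))
  · obtain ⟨b, -, hb⟩ := hcomp a
    exact ⟨b, hb⟩
end

section
/- Let k, n, t be integers with 2 < k < n < 2^k and t ≥ 1, and suppose there exists a perfect factor PF(n, k), F : Fin 2^{n−k} → (ZMod 2^k → ZMod 2), such that no sequence F(a) is self-dual and for every index a there exists an index b with F(b)(i) = F(a)(i) + 1 for all i. Then there exists a (2^k, 2^{t+1}; n, 2^t)-de Bruijn array code of size 2^{n·2^t − k − t − 1}. -/
/-- `C` is an `(r, s; n, m)`-de Bruijn array code of size `Δ`: every `n × m` binary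
matrix appears exactly once as a window in exactly one codeword. -/
def IsDBAC (r s n m Δ : ℕ) (C : Fin Δ → (ZMod r × ZMod s → ZMod 2)) : Prop :=
  ∀ M : Fin n → Fin m → ZMod 2,
    ∃! p : Fin Δ × ZMod r × ZMod s,
      ∀ (x : Fin n) (y : Fin m),
        C p.1 (p.2.1 + (x : ℕ), p.2.2 + (y : ℕ)) = M x y

theorem key_code {G α T : Type} [AddCommGroup G] [Finite G] [Finite T] (S : Set (G → α))
    (w : (G → α) → T)
    (hs : ∀ A ∈ S, ∀ g : G, (fun x => A (g + x)) ∈ S)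
    (hw : ∀ M, ∃! A, A ∈ S ∧ w A = M)
    (hfree : ∀ A ∈ S, ∀ g : G, (fun x => A (g + x)) = A → g = 0)
    (Δ : ℕ) (hΔ : Δ * Nat.card G = Nat.card T) :
    ∃ C : Fin Δ → G → α, ∀ M, ∃! p : Fin Δ × G, w (fun x => C p.1 (p.2 + x)) = M := by
  let st : Setoid S :=
    { r := fun A B => ∃ g : G, B.1 = fun x => A.1 (g + x)
      iseqv :=
        { refl := fun A => ⟨0, by simp⟩
          symm := by
            rintro A B ⟨g, hg⟩
            refine ⟨-g, ?_⟩
            rw [hg]; funext x; simp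
          trans := by
            rintro A B D ⟨g, hg⟩ ⟨h, hh⟩
            refine ⟨g + h, ?_⟩
            rw [hh, hg]; funext x; simp [add_assoc] } }
  let f : Quotient st × G → T := fun p => w (fun x => p.1.out.1 (p.2 + x))
  have hwinj : ∀ A B, A ∈ S → B ∈ S → w A = w B → A = B := by
    intro A B hA hB h
    exact (hw (w B)).unique ⟨hA, h⟩ ⟨hB, rfl⟩
  have hf : Function.Bijective f := by
    constructor
    · rintro ⟨q, g⟩ ⟨q', g'⟩ h
      have h1 := hwinj _ _ (hs _ q.out.2 g) (hs _ q'.out.2 g') h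
      have h3 : ∀ x, q.out.1 (g + x) = q'.out.1 (g' + x) := fun x => congrFun h1 x
      have h2 : q = q' := by
        rw [← Quotient.out_eq q, ← Quotient.out_eq q']
        apply Quotient.sound
        refine ⟨g - g', ?_⟩
        funext x
        have := h3 (x - g')
        rw [show g + (x - g') = g - g' + x by abel, show g' + (x - g') = x by abel] at this
        exact this.symm
      subst h2
      have : g - g' = 0 := by
        apply hfree _ q.out.2
        funext x
        have := h3 (x - g')
        rw [show g + (x - g') = g - g' + x by abel, show g' + (x - g') = x by abel] at this
        exact this
      rw [sub_eq_zero.mp this]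
    · intro M
      obtain ⟨A, ⟨hA, hM⟩, -⟩ := hw M
      obtain ⟨g, hg⟩ : st.r (Quotient.mk st ⟨A, hA⟩).out ⟨A, hA⟩ := Quotient.mk_out (s := st) _
      refine ⟨(Quotient.mk st ⟨A, hA⟩, g), ?_⟩
      rw [← hM]
      exact congrArg w hg.symm
  have hfin : Finite (Quotient st × G) := Finite.of_injective f hf.1
  have hfq : Finite (Quotient st) := Finite.of_injective (fun q => (q, (0 : G))) (by
    intro a b h; exact (Prod.mk.inj h).1)
  have hc : Nat.card (Quotient st) = Δ := by
    have h1 := Nat.card_congr (Equiv.ofBijective f hf)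
    rw [Nat.card_prod, ← hΔ] at h1
    exact Nat.eq_of_mul_eq_mul_right Nat.card_pos h1
  let e : Fin Δ ≃ Quotient st := (Finite.equivFinOfCardEq hc).symm
  refine ⟨fun c => (e c).out.1, fun M => ?_⟩
  have hb : Function.Bijective (fun p : Fin Δ × G => f (e p.1, p.2)) :=
    hf.comp (e.prodCongr (Equiv.refl G)).bijective
  exact hb.existsUnique M

theorem two_free {G : Type} [AddCommGroup G] (P : G → Prop)
    (hd : ∀ g, P g → P (g + g)) (h2 : ∀ g, P g → g + g = 0 → g = 0) (e : ℕ) :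
    ∀ g, P g → (2 ^ e) • g = 0 → g = 0 := by
  induction e with
  | zero => intro g _ h; simpa using h
  | succ e ih =>
    intro g hg h
    apply h2 g hg
    apply ih _ (hd g hg)
    rw [← two_nsmul, ← mul_nsmul', ← pow_succ]; exact h

theorem half_zmod (m N : ℕ) (hm : 0 < m) (hN : N = m + m) (h : ZMod N) (hh : h + h = 0)
    (h0 : h ≠ 0) : h = (m : ZMod N) := by
  have : NeZero N := ⟨by omega⟩
  have hl := ZMod.val_lt h
  have hp : h.val ≠ 0 := by rwa [Ne, ZMod.val_eq_zero]
  have h1 : ((h.val + h.val : ℕ) : ZMod N) = 0 := by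
    push_cast; rw [ZMod.natCast_zmod_val]; exact hh
  rw [ZMod.natCast_eq_zero_iff] at h1
  obtain ⟨c, hc⟩ := h1
  have : h.val = m := by
    have : c = 1 := by
      have h2 : N * c < N * 2 := by omega
      have := Nat.lt_of_mul_lt_mul_left h2
      have : c ≠ 0 := by rintro rfl; omega
      omega
    subst this; omega
  rw [← this, ZMod.natCast_zmod_val]

theorem zmod_split (m N : ℕ) (hm : 0 < m) (hN : N = m + m) (h : ZMod N) :
    ∃ y : Fin m, h = ((y : ℕ) : ZMod N) ∨ h = ((y : ℕ) : ZMod N) + (m : ZMod N) := by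
  have : NeZero N := ⟨by omega⟩
  have hl := ZMod.val_lt h
  by_cases hc : h.val < m
  · exact ⟨⟨h.val, hc⟩, Or.inl (by simp)⟩
  · refine ⟨⟨h.val - m, by omega⟩, Or.inr ?_⟩
    rw [← Nat.cast_add, Nat.sub_add_cancel (by omega), ZMod.natCast_zmod_val]

theorem core_dbac (k n t r m N D : ℕ) (hr : r = 2 ^ k) (hmdef : m = 2 ^ t)
    (hNdef : N = 2 ^ (t + 1)) (hkn : k < n)
    (F : Fin D → (ZMod r → ZMod 2))
    (hF : ∀ x : Fin n → ZMod 2, ∃! p : Fin D × ZMod r, ∀ i : Fin n, F p.1 (p.2 + (i : ℕ)) = x i)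
    (hFsd : ∀ a, ¬ IsSelfDual (F a))
    (hFc : ∀ a, ∃ b, ∀ i : ZMod r, F b i = F a i + 1) :
    ∃ C : Fin (2 ^ (n * m - k - t - 1)) → (ZMod r × ZMod N → ZMod 2),
      IsDBAC r N n m (2 ^ (n * m - k - t - 1)) C := by
  classical
  have hm : 0 < m := by rw [hmdef]; positivity
  have hN : N = m + m := by rw [hNdef, hmdef, pow_succ]; omega
  have : NeZero r := ⟨by rw [hr]; positivity⟩
  have : NeZero N := ⟨by omega⟩
  have two0 : ∀ a : ZMod 2, a + 1 + 1 = a := by decide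
  have hmm : (m : ZMod N) + (m : ZMod N) = 0 := by
    rw [← Nat.cast_add, ← hN, ZMod.natCast_self]
  -- admissible columns
  let P : Set (ZMod r → ZMod 2) := {s | ∃ a p, s = fun i => F a (p + i)}
  have Pshift : ∀ s ∈ P, ∀ g, (fun i => s (g + i)) ∈ P := by
    rintro s ⟨a, p, rfl⟩ g
    exact ⟨a, p + g, by funext i; simp [add_assoc]⟩
  have Pcompl : ∀ s ∈ P, (fun i => s i + 1) ∈ P := by
    rintro s ⟨a, p, rfl⟩
    obtain ⟨b, hb⟩ := hFc a
    exact ⟨b, p, by funext i; simp [hb]⟩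
  have Puniq : ∀ s ∈ P, ∀ s' ∈ P, (∀ i : Fin n, s ((i : ℕ) : ZMod r) = s' ((i : ℕ) : ZMod r)) →
      s = s' := by
    rintro s ⟨a, p, rfl⟩ s' ⟨b, q, rfl⟩ h
    have := (hF (fun i => F b (q + (i : ℕ)))).unique (y₁ := (a, p)) (y₂ := (b, q)) h
      (fun i => rfl)
    cases this; rfl
  have Pex : ∀ x : Fin n → ZMod 2, ∃ s ∈ P, ∀ i : Fin n, s ((i : ℕ) : ZMod r) = x i := by
    intro x
    obtain ⟨⟨a, p⟩, h, -⟩ := hF x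
    exact ⟨_, ⟨a, p, rfl⟩, h⟩
  have Pfree : ∀ s ∈ P, ∀ g, (∀ i, s (g + i) = s i) → g = 0 := by
    rintro s ⟨a, p, rfl⟩ g h
    have := (hF (fun i => F a (p + (i : ℕ)))).unique (y₁ := (a, p + g)) (y₂ := (a, p))
      (fun i => by simpa [add_assoc] using h (i : ℕ)) (fun i => rfl)
    simpa using congrArg Prod.snd this
  have Psd : ∀ s ∈ P, ∀ g, ¬ ∀ i, s (g + i) = s i + 1 := by
    rintro s ⟨a, p, rfl⟩ g h
    apply hFsd a
    refine ⟨g, fun i => ?_⟩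
    have := h (i - p)
    simp only at this
    rw [show p + (g + (i - p)) = i + g by ring, show p + (i - p) = i by ring] at this
    exact this
  choose E hEP hE using Pex
  let S : Set (ZMod r × ZMod N → ZMod 2) :=
    {A | (∀ h, (fun i => A (i, h)) ∈ P) ∧ ∀ i h, A (i, h + (m : ZMod N)) = A (i, h) + 1}
  let w : (ZMod r × ZMod N → ZMod 2) → (Fin n → Fin m → ZMod 2) :=
    fun A x y => A (((x : ℕ) : ZMod r), ((y : ℕ) : ZMod N))
  have hs : ∀ A ∈ S, ∀ g : ZMod r × ZMod N, (fun x => A (g + x)) ∈ S := by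
    rintro A ⟨hA1, hA2⟩ ⟨g, g'⟩
    refine ⟨fun h => Pshift _ (hA1 (g' + h)) g, fun i h => ?_⟩
    have := hA2 (g + i) (g' + h)
    simpa [add_assoc] using this
  have hw : ∀ M, ∃! A, A ∈ S ∧ w A = M := by
    intro M
    let A : ZMod r × ZMod N → ZMod 2 := fun q =>
      if hq : q.2.val < m then E (fun x => M x ⟨q.2.val, hq⟩) q.1
      else if hq' : q.2.val - m < m then E (fun x => M x ⟨q.2.val - m, hq'⟩) q.1 + 1 else 0
    have hA1 : ∀ i (y : Fin m), A (i, ((y : ℕ) : ZMod N)) = E (fun x => M x y) i := by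
      intro i y
      have hv : ((y : ℕ) : ZMod N).val = y := ZMod.val_natCast_of_lt (by omega)
      simp [A, hv]
    have hA2 : ∀ i (y : Fin m), A (i, ((y : ℕ) : ZMod N) + (m : ZMod N))
        = E (fun x => M x y) i + 1 := by
      intro i y
      have hv : (((y : ℕ) : ZMod N) + (m : ZMod N)).val = y + m := by
        rw [← Nat.cast_add]; exact ZMod.val_natCast_of_lt (by omega)
      simp [A, hv]
    refine ⟨A, ⟨⟨fun h => ?_, fun i h => ?_⟩, ?_⟩, ?_⟩
    · obtain ⟨y, rfl | rfl⟩ := zmod_split m N hm hN h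
      · simp only [hA1]; exact hEP _
      · simp only [hA2]; exact Pcompl _ (hEP _)
    · obtain ⟨y, rfl | rfl⟩ := zmod_split m N hm hN h
      · rw [hA1, hA2]
      · rw [add_assoc, hmm, add_zero, hA1, hA2, two0]
    · funext x y
      simp only [w, hA1, hE]
    · rintro B ⟨⟨hB1, hB2⟩, hB3⟩
      have hB4 : ∀ i (y : Fin m), B (i, ((y : ℕ) : ZMod N)) = E (fun x => M x y) i := by
        intro i y
        refine congrFun (Puniq _ (hB1 _) _ (hEP _) fun x => ?_) i
        rw [hE]
        exact congrFun (congrFun hB3 x) y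
      funext ⟨i, h⟩
      obtain ⟨y, rfl | rfl⟩ := zmod_split m N hm hN h
      · rw [hA1, hB4]
      · rw [hA2, hB2, hB4]
  have hfree : ∀ A ∈ S, ∀ g : ZMod r × ZMod N, (fun x => A (g + x)) = A → g = 0 := by
    rintro A ⟨hA1, hA2⟩ g hg
    refine two_free (fun g => ∀ x, A (g + x) = A x) ?_ ?_ (k + (t + 1)) g
      (fun x => congrFun hg x) ?_
    · intro g hg x
      rw [add_assoc, hg, hg]
    · rintro ⟨g, h⟩ hg h2
      have hh : h + h = 0 := congrArg Prod.snd h2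
      by_cases h0 : h = 0
      · subst h0
        have : g = 0 := Pfree _ (hA1 0) g (fun i => by simpa using hg (i, 0))
        rw [this]; rfl
      · exfalso
        have hhm := half_zmod m N hm hN h hh h0
        refine Psd _ (hA1 0) g (fun i => ?_)
        have h3 := hg (i, 0)
        have h4 := hA2 (g + i) 0
        simp only [Prod.mk_add_mk, add_zero, zero_add, hhm] at h3 h4
        rw [← h3, h4, two0]
    · have e1 : ((2 ^ k : ℕ) : ZMod r) = 0 := by rw [← hr]; exact ZMod.natCast_self r
      have e2 : ((2 ^ (t + 1) : ℕ) : ZMod N) = 0 := by rw [← hNdef]; exact ZMod.natCast_self N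
      ext
      · rw [Prod.smul_fst, nsmul_eq_mul, pow_add, Nat.cast_mul, e1]; simp
      · rw [Prod.smul_snd, nsmul_eq_mul, pow_add, Nat.cast_mul, e2]; simp
  have hle : k + t + 1 ≤ n * m := by
    have h1 : t + 1 ≤ m := hmdef ▸ Nat.lt_two_pow_self
    have h2 : (k + 1) * m ≤ n * m := Nat.mul_le_mul_right _ hkn
    nlinarith
  have hΔ : 2 ^ (n * m - k - t - 1) * Nat.card (ZMod r × ZMod N)
      = Nat.card (Fin n → Fin m → ZMod 2) := by
    have hT : Nat.card (Fin n → Fin m → ZMod 2) = 2 ^ (n * m) := by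
      simp only [Nat.card_eq_fintype_card, Fintype.card_fun, Fintype.card_fin, ZMod.card]
      rw [← pow_mul, mul_comm]
    rw [hT, Nat.card_prod, Nat.card_zmod, Nat.card_zmod, hr, hNdef, ← pow_add, ← pow_add]
    congr 1
    omega
  obtain ⟨C, hC⟩ := key_code S w hs hw hfree _ hΔ
  refine ⟨C, fun M => ?_⟩
  obtain ⟨p, hp, hu⟩ := hC M
  refine ⟨p, fun x y => congrFun (congrFun hp x) y, fun q hq => hu q ?_⟩
  funext x y
  exact hq x y

theorem stmt_8 (k n t : ℕ) (hk : 2 < k) (hkn : k < n) (hn : n < 2 ^ k) (ht : 1 ≤ t)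
    (F : Fin (2 ^ (n - k)) → (ZMod (2 ^ k) → ZMod 2))
    (hF : IsPF n k (2 ^ (n - k)) F)
    (hFsd : ∀ a, ¬ IsSelfDual (F a))
    (hFc : ∀ a, ∃ b, ∀ i : ZMod (2 ^ k), F b i = F a i + 1) :
    ∃ C : Fin (2 ^ (n * 2 ^ t - k - t - 1)) → (ZMod (2 ^ k) × ZMod (2 ^ (t + 1)) → ZMod 2),
      IsDBAC (2 ^ k) (2 ^ (t + 1)) n (2 ^ t) (2 ^ (n * 2 ^ t - k - t - 1)) C := by
  exact core_dbac k n t _ _ _ _ rfl rfl rfl hkn F hF hFsd hFc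
end

section
/- Let k, n, t be integers with k ≥ 1 and 1 ≤ t ≤ n − k. Then there exists a (2^k, 2^t; n, 1)-de Bruijn array code of size 2^{n−k−t} if and only if k ≤ n < 2^k. -/
open Finset
/-- difference operator condition: family indexed by ι of P-periodic sequences, every n-window once -/
structure PFam (P n : ℕ) (ι : Type) (F : ι → ℕ → ZMod 2) : Prop where
  per : ∀ c i, F c (i + P) = F c i
  win : ∀ w : ℕ → ZMod 2, ∃! p : ι × ℕ, p.2 < P ∧ ∀ x < n, F p.1 (p.2 + x) = w x

lemma z2 (a b : ZMod 2) : a + b = 0 ↔ a = b := by revert a b; decide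
lemma z2' (a : ZMod 2) : a + a = 0 := by revert a; decide
lemma z3 (a b : ZMod 2) : a ≠ b ↔ a = b + 1 := by revert a b; decide

def psum (f : ℕ → ZMod 2) (i : ℕ) : ZMod 2 := ∑ j ∈ range i, f j
lemma psum_succ (f) (i : ℕ) : psum f (i+1) = psum f i + f i := sum_range_succ _ _

/-- two sequences agree on window iff agree at start and differences agree. -/
lemma win_iff (g w : ℕ → ZMod 2) (i n : ℕ) :
    (∀ x < n + 1, g (i + x) = w x) ↔
      g i = w 0 ∧ ∀ x < n, g (i + x + 1) + g (i + x) = w (x + 1) + w x := by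
  constructor
  · intro h
    refine ⟨by simpa using h 0 (by omega), fun x hx => ?_⟩
    rw [h x (by omega), add_assoc i x 1, h (x+1) (by omega)]
  · rintro ⟨h0, h⟩ x
    induction x with
    | zero => intro _; simpa using h0
    | succ x ih =>
      intro hx
      have h1 := ih (by omega)
      have h2 := h x (by omega)
      rw [h1] at h2
      rw [← add_assoc]
      exact add_right_cancel h2

lemma per_mul {P : ℕ} {f : ℕ → ZMod 2} (h : ∀ i, f (i + P) = f i) (i m : ℕ) :
    f (i + P * m) = f i := by
  induction m with
  | zero => simp
  | succ m ih => rw [Nat.mul_succ, ← add_assoc, h, ih]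

lemma lift_step {P n : ℕ} {ι : Type} {F : ι → ℕ → ZMod 2} (h : PFam P n ι F)
    (hp : ∀ c i, psum (F c) (i + P) = psum (F c) i) :
    PFam P (n+1) (ι × ZMod 2) (fun c i => c.2 + psum (F c.1) i) := by
  refine ⟨fun c i => by simp [hp], fun w => ?_⟩
  obtain ⟨⟨c, i⟩, ⟨hi, hc⟩, hu⟩ := h.win (fun x => w (x+1) + w x)
  have key : ∀ (b : ZMod 2) (c : ι) (x : ℕ), (b + psum (F c) (x + 1)) + (b + psum (F c) x) = F c x := by
    intro b c x
    rw [psum_succ]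
    linear_combination z2' b + z2' (psum (F c) x)
  refine ⟨((c, w 0 + psum (F c) i), i), ⟨hi, ?_⟩, ?_⟩
  · dsimp only
    rw [win_iff (fun j => (w 0 + psum (F c) i) + psum (F c) j)]
    refine ⟨?_, fun x hx => ?_⟩
    · linear_combination z2' (psum (F c) i)
    · simp only [key]; exact hc x hx
  · rintro ⟨⟨c', b⟩, i'⟩ ⟨hi', hc'⟩
    dsimp only at hi' hc'
    rw [win_iff (fun i => b + psum (F c') i)] at hc'
    simp only [key] at hc'
    have := hu (c', i') ⟨hi', hc'.2⟩
    simp only [Prod.mk.injEq] at this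
    obtain ⟨rfl, rfl⟩ := this
    have h0 := hc'.1
    simp only [Prod.mk.injEq, true_and, and_true]
    linear_combination h0 - z2' (psum (F c') i')

lemma psum_per {Q : ℕ} {f : ℕ → ZMod 2} (h : ∀ i, f (i + Q) = f i) (i : ℕ) :
    psum f (i + Q) = psum f i + psum f Q := by
  induction i with
  | zero => simp [psum]
  | succ i ih => rw [add_right_comm, psum_succ, psum_succ, ih, h]; ring

lemma double_step {Q n : ℕ} {ι : Type} {F : ι → ℕ → ZMod 2} (h : PFam Q n ι F)
    (hodd : ∀ c, psum (F c) Q = 1) :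
    PFam (2 * Q) (n+1) ι (fun c i => psum (F c) i) ∧
      ∀ c i, psum (F c) (i + Q) = psum (F c) i + 1 := by
  have hh : ∀ c i, psum (F c) (i + Q) = psum (F c) i + 1 := fun c i => by
    rw [psum_per (h.per c), hodd]
  have key : ∀ (c : ι) (x : ℕ), psum (F c) (x + 1) + psum (F c) x = F c x := by
    intro c x
    rw [psum_succ]
    linear_combination z2' (psum (F c) x)
  refine ⟨⟨fun c i => ?_, fun w => ?_⟩, hh⟩
  · rw [two_mul, ← add_assoc, hh, hh]; linear_combination z2' 1
  obtain ⟨⟨c, i⟩, ⟨hi, hc⟩, hu⟩ := h.win (fun x => w (x+1) + w x)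
  have hu' : ∀ (c' : ι) (i' : ℕ), i' < 2 * Q → (∀ x < n+1, psum (F c') (i' + x) = w x) →
      c' = c ∧ (i' = i ∨ i' = i + Q) ∧ psum (F c) i' = w 0 := by
    intro c' i' hi' hc'
    rw [win_iff (fun i => psum (F c') i)] at hc'
    simp only [key] at hc'
    rcases lt_or_ge i' Q with hlt | hge
    · have := hu (c', i') ⟨hlt, hc'.2⟩
      simp only [Prod.mk.injEq] at this
      obtain ⟨rfl, rfl⟩ := this
      exact ⟨rfl, Or.inl rfl, hc'.1⟩
    · obtain ⟨d, rfl⟩ := Nat.exists_eq_add_of_le' hge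
      have := hu (c', d) ⟨by omega, fun x hx => by
        have := hc'.2 x hx
        rw [add_right_comm, h.per] at this; exact this⟩
      simp only [Prod.mk.injEq] at this
      obtain ⟨rfl, rfl⟩ := this
      exact ⟨rfl, Or.inr rfl, hc'.1⟩
  by_cases h0 : psum (F c) i = w 0
  · refine ⟨(c, i), ⟨by dsimp only; dsimp only at hi; omega, ?_⟩, ?_⟩
    · rw [win_iff (fun i => psum (F c) i)]
      simp only [key]
      exact ⟨h0, hc⟩
    · rintro ⟨c', i'⟩ ⟨hi', hc'⟩
      obtain ⟨rfl, h2 | h2, h3⟩ := hu' c' i' hi' hc'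
      · rw [h2]
      · rw [h2, hh, h0] at h3; simp at h3
  · refine ⟨(c, i + Q), ⟨by dsimp only; dsimp only at hi; omega, ?_⟩, ?_⟩
    · rw [win_iff (fun i => psum (F c) i)]
      simp only [key]
      refine ⟨by rw [hh]; exact ((z3 _ _).1 (Ne.symm h0)).symm, fun x hx => ?_⟩
      rw [add_right_comm, h.per]; exact hc x hx
    · rintro ⟨c', i'⟩ ⟨hi', hc'⟩
      obtain ⟨rfl, h2 | h2, h3⟩ := hu' c' i' hi' hc'
      · rw [h2] at h3; exact absurd h3 h0
      · rw [h2]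

/-- shift operator -/
def shiftE : Module.End (ZMod 2) (ℕ → ZMod 2) where
  toFun f i := f (i + 1)
  map_add' _ _ := rfl
  map_smul' _ _ := rfl

open Polynomial in
noncomputable def act (p : (ZMod 2)[X]) (f : ℕ → ZMod 2) : ℕ → ZMod 2 := aeval shiftE p f

open Polynomial in
lemma act_mul (p q : (ZMod 2)[X]) (f) : act (p * q) f = act p (act q f) := by
  simp [act]

open Polynomial in
lemma act_Xpow (m : ℕ) (f) (i : ℕ) : act (X ^ m + 1) f i = f (i + m) + f i := by
  have : ∀ m i, (shiftE ^ m) f i = f (i + m) := by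
    intro m
    induction m with
    | zero => intro i; rfl
    | succ m ih =>
      intro i
      rw [pow_succ', Module.End.mul_apply]
      change (shiftE ^ m) f (i + 1) = _
      rw [ih]; congr 1; omega
  simp [act, this]

open Polynomial in
lemma act_zero (p : (ZMod 2)[X]) : act p 0 = 0 := by simp [act]

open Polynomial in
lemma act_two (k : ℕ) (f) (i : ℕ) : act ((X + 1) ^ (2 ^ k)) f i = f (i + 2 ^ k) + f i := by
  rw [add_pow_char_pow, one_pow, act_Xpow]

open Polynomial in
lemma lift_many {k n m c : ℕ} {ι : Type} [Fintype ι] {F : ι → ℕ → ZMod 2} (h : PFam (2 ^ k) n ι F)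
    (hk : ∀ a, act ((X + 1) ^ c) (F a) = 0) (hc : c + m ≤ 2 ^ k) :
    ∃ (κ : Type) (_ : Fintype κ) (G : κ → ℕ → ZMod 2), PFam (2 ^ k) (n + m) κ G := by
  induction m generalizing n c ι with
  | zero => exact ⟨ι, inferInstance, F, h⟩
  | succ m ih =>
    have hd : ∀ (b : ZMod 2) a, act (X + 1) (fun i => b + psum (F a) i) = F a := by
      intro b a
      funext i
      have := act_Xpow 1 (fun i => b + psum (F a) i) i
      rw [pow_one] at this
      rw [this, psum_succ]
      linear_combination z2' b + z2' (psum (F a) i)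
    have hk' : ∀ (b : ZMod 2) a, act ((X + 1) ^ (c + 1)) (fun i => b + psum (F a) i) = 0 := by
      intro b a
      rw [pow_succ, act_mul, hd, hk]
    have hl := lift_step h (fun a i => by
      have h1 := act_two k (fun i => 0 + psum (F a) i) i
      have h2 : (X + 1 : (ZMod 2)[X]) ^ (2 ^ k) = (X + 1) ^ (2 ^ k - (c + 1)) * (X + 1) ^ (c + 1) := by
        rw [← pow_add]; congr 1; omega
      rw [h2, act_mul, hk', act_zero] at h1
      simpa [z2] using ((z2 _ _).1 h1.symm))
    have := ih (c := c + 1) hl (fun a => hk' _ _) (by omega)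
    rw [show n + (m + 1) = n + 1 + m by omega]
    exact this

open Polynomial in
lemma kill_of_anti {k : ℕ} {f : ℕ → ZMod 2} (h : ∀ i, f (i + 2 ^ k) = f i + 1) :
    act ((X + 1) ^ (2 ^ k + 1)) f = 0 := by
  rw [pow_succ', act_mul]
  funext i
  have := act_Xpow 1 (act ((X + 1) ^ 2 ^ k) f) i
  rw [pow_one] at this
  rw [this, act_two, act_two, h, h]
  show _ = (0 : ZMod 2)
  linear_combination z2' (f (i+1)) + z2' (f i) + z2' 1

/-! Base B : all anti-periodic sequences up to shift -/

lemma anti_mul {Q : ℕ} {f : ℕ → ZMod 2} (h : ∀ i, f (i + Q) = f i + 1) (i m : ℕ) :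
    f (i + Q * m) = f i + m := by
  induction m with
  | zero => simp
  | succ m ih => rw [Nat.mul_succ, ← add_assoc, h, ih]; push_cast; ring

lemma anti_per {Q : ℕ} {f : ℕ → ZMod 2} (h : ∀ i, f (i + Q) = f i + 1) (i : ℕ) :
    f (i + 2 * Q) = f i := by
  have := anti_mul h i 2
  rw [mul_comm, this]
  have : ((2 : ℕ) : ZMod 2) = 0 := by decide
  rw [this, add_zero]

lemma anti_no_per {k d : ℕ} {f : ℕ → ZMod 2} (h : ∀ i, f (i + 2 ^ k) = f i + 1)
    (i0 : ℕ) (hd0 : 0 < d) (hd : d < 2 * 2 ^ k) (hp : ∀ x, f (i0 + x + d) = f (i0 + x)) : False := by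
  obtain ⟨v, o, ho, rfl⟩ := Nat.exists_eq_two_pow_mul_odd hd0.ne'
  have hv : v ≤ k := by
    by_contra hcon
    have h1 : 2 ^ (k + 1) ≤ 2 ^ v := Nat.pow_le_pow_right (by norm_num) (by omega)
    have h2 : 2 ^ v * 1 ≤ 2 ^ v * o := Nat.mul_le_mul_left _ ho.pos
    rw [pow_succ] at h1
    omega
  have h3 := per_mul (f := fun x => f (i0 + x)) (P := 2 ^ v * o) (fun x => by
    have := hp x; rwa [add_assoc] at this) 0 (2 ^ (k - v))
  have h4 : 2 ^ v * o * 2 ^ (k - v) = 2 ^ k * o := by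
    rw [mul_right_comm, ← pow_add]; congr 2; omega
  rw [h4, zero_add, add_zero, anti_mul h, (ZMod.natCast_eq_one_iff_odd.2 ho)] at h3
  simp at h3

abbrev AntiSeq (Q : ℕ) := {f : ℕ → ZMod 2 // ∀ i, f (i + Q) = f i + 1}

def antiSetoid (Q : ℕ) : Setoid (AntiSeq Q) where
  r f g := ∃ i, ∀ x, f.1 (i + x) = g.1 x
  iseqv := by
    refine ⟨fun f => ⟨0, fun x => by simp⟩, ?_, ?_⟩
    · rintro f g ⟨i, hi⟩
      rcases Nat.eq_zero_or_pos Q with rfl | hQ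
      · have := f.2 0; simp at this
      refine ⟨2 * Q * i - i, fun x => ?_⟩
      rw [← hi, ← per_mul (anti_per f.2) x i]
      have : i ≤ 2 * Q * i := Nat.le_mul_of_pos_left _ (by omega)
      refine congrArg _ ?_
      generalize 2 * Q * i = z at *
      omega
    · rintro f g h ⟨i, hi⟩ ⟨j, hj⟩
      exact ⟨i + j, fun x => by rw [add_assoc, hi, hj]⟩

lemma baseB (k : ℕ) : ∃ (κ : Type) (_ : Fintype κ) (G : κ → ℕ → ZMod 2),
    PFam (2 * 2 ^ k) (2 ^ k) κ G ∧ ∀ c i, G c (i + 2 ^ k) = G c i + 1 := by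
  classical
  have hQ : 0 < 2 ^ k := by positivity
  have ext : ∀ f g : AntiSeq (2 ^ k), (∀ x < 2 ^ k, f.1 x = g.1 x) → f = g := by
    intro f g h
    apply Subtype.ext
    funext i
    rw [← Nat.mod_add_div i (2 ^ k), anti_mul f.2, anti_mul g.2, h _ (Nat.mod_lt _ hQ)]
  have : Finite (AntiSeq (2 ^ k)) := by
    apply Finite.of_injective (fun f : AntiSeq (2 ^ k) => fun x : Fin (2 ^ k) => f.1 x)
    intro f g h
    exact ext f g fun x hx => congrFun h ⟨x, hx⟩
  have : Fintype (AntiSeq (2 ^ k)) := Fintype.ofFinite _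
  let := antiSetoid (2 ^ k)
  have : Finite (Quotient (antiSetoid (2 ^ k))) := Quotient.finite _
  refine ⟨Quotient (antiSetoid (2 ^ k)), Fintype.ofFinite _, fun c => c.out.1, ⟨fun c => anti_per c.out.2, fun w => ?_⟩,
    fun c => c.out.2⟩
  let g : AntiSeq (2 ^ k) := ⟨fun i => w (i % 2 ^ k) + ((i / 2 ^ k : ℕ) : ZMod 2), fun i => by
    dsimp only
    rw [Nat.add_mod_right, Nat.add_div_right _ hQ]; push_cast; ring⟩
  have hg : ∀ x < 2 ^ k, g.1 x = w x := fun x hx => by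
    simp [g, Nat.mod_eq_of_lt hx, Nat.div_eq_of_lt hx]
  have hg' : ∀ (f : AntiSeq (2 ^ k)) i, (∀ x < 2 ^ k, f.1 (i + x) = w x) → ∀ x, f.1 (i + x) = g.1 x := by
    intro f i h
    have := ext ⟨fun x => f.1 (i + x), fun x => by dsimp only; rw [← add_assoc, f.2]⟩ g
      (fun x hx => by rw [hg x hx]; exact h x hx)
    intro x
    rw [← this]
  obtain ⟨i, hi⟩ : (⟦g⟧ : Quotient (antiSetoid (2 ^ k))).out ≈ g := Quotient.mk_out g
  refine ⟨(⟦g⟧, i % (2 * 2 ^ k)), ⟨Nat.mod_lt _ (by omega), fun x hx => ?_⟩, ?_⟩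
  · dsimp only
    rw [← hg x hx, ← hi x, ← per_mul (anti_per (⟦g⟧ : Quotient (antiSetoid (2 ^ k))).out.2) _ (i / (2 * 2 ^ k))]
    refine congrArg _ ?_
    have := Nat.mod_add_div i (2 * 2 ^ k)
    omega
  · rintro ⟨c', i'⟩ ⟨hi', hc'⟩
    have h1 := hg' _ _ hc'
    dsimp only at h1 hi'
    have hc : c' = ⟦g⟧ := by
      rw [← Quotient.out_eq c']
      exact Quotient.sound ⟨i', h1⟩
    subst hc
    have h2 : ∀ x, (⟦g⟧ : Quotient (antiSetoid (2 ^ k))).out.1 (i % (2 * 2 ^ k) + x) = g.1 x := by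
      intro x
      rw [← hi x, ← per_mul (anti_per (⟦g⟧ : Quotient (antiSetoid (2 ^ k))).out.2) _ (i / (2 * 2 ^ k))]
      refine congrArg _ ?_
      have := Nat.mod_add_div i (2 * 2 ^ k)
      omega
    have hlt : i % (2 * 2 ^ k) < 2 * 2 ^ k := Nat.mod_lt _ (by omega)
    set j := i % (2 * 2 ^ k)
    rcases lt_trichotomy i' j with h | h | h
    · exfalso
      refine anti_no_per (Subtype.property (⟦g⟧ : Quotient (antiSetoid (2 ^ k))).out) i' (d := j - i') (by omega) (by omega) (fun x => ?_)
      rw [h1, ← h2]; refine congrArg _ ?_; omega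
    · rw [h]
    · exfalso
      refine anti_no_per (Subtype.property (⟦g⟧ : Quotient (antiSetoid (2 ^ k))).out) j (d := i' - j) (by omega) (by omega) (fun x => ?_)
      rw [h2, ← h1]; refine congrArg _ ?_; omega

/-! de Bruijn sequence from m-sequence -/
open Polynomial in
lemma field_fact (k : ℕ) (hk : 2 ≤ k) : ∃ (K : Type) (_ : Field K) (_ : Fintype K) (_ : Algebra (ZMod 2) K)
    (a : K) (l : K →ₗ[ZMod 2] ZMod 2), Fintype.card K = 2 ^ k ∧ a ≠ 0 ∧ a ≠ 1 ∧ orderOf a = 2 ^ k - 1 ∧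
      (∀ b : K, b ≠ 0 → ∃ j < 2 ^ k - 1, a ^ j = b) ∧
      (∀ j < k - 1, l (a ^ j) = 0) ∧ l ((a - 1)⁻¹) = 1 ∧
      (∀ b : K, (∀ x < k, l (b * a ^ x) = 0) → b = 0) := by
  classical
  let K := GaloisField 2 k
  let : Fintype K := Fintype.ofFinite K
  have hcard : Fintype.card K = 2 ^ k := by
    rw [← Nat.card_eq_fintype_card]; exact GaloisField.card 2 k (by omega)
  have hfr : Module.finrank (ZMod 2) K = k := GaloisField.finrank 2 (by omega)
  have h4 : 2 ^ 2 ≤ 2 ^ k := Nat.pow_le_pow_right (by norm_num) hk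
  obtain ⟨u, hu⟩ := IsCyclic.exists_generator (α := Kˣ)
  have hou : orderOf u = 2 ^ k - 1 := by
    rw [orderOf_eq_card_of_forall_mem_zpowers hu, Nat.card_eq_fintype_card, Fintype.card_units, hcard]
  have hoa : orderOf (u : K) = 2 ^ k - 1 := by rw [orderOf_units, hou]
  have hgen : ∀ b : K, b ≠ 0 → ∃ j < 2 ^ k - 1, (u : K) ^ j = b := by
    intro b hb
    have h1 := hu (Units.mk0 b hb)
    rw [← mem_powers_iff_mem_zpowers, (isOfFinOrder_of_finite u).mem_powers_iff_mem_range_orderOf] at h1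
    rw [hou] at h1
    simp only [Finset.mem_image, Finset.mem_range] at h1
    obtain ⟨j, hj, h⟩ := h1
    exact ⟨j, hj, by rw [← Units.val_pow_eq_pow_val, h]; rfl⟩
  have hne1 : (u : K) ≠ 1 := by
    intro h; rw [h, orderOf_one] at hoa; omega
  have htop : IntermediateField.adjoin (ZMod 2) {(u : K)} = ⊤ := by
    rw [eq_top_iff]
    intro b _
    by_cases hb : b = 0
    · rw [hb]; exact zero_mem _
    · obtain ⟨j, _, rfl⟩ := hgen b hb
      exact pow_mem (IntermediateField.mem_adjoin_simple_self _ _) _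
  have hdeg : (minpoly (ZMod 2) (u : K)).natDegree = k := by
    rw [(Field.primitive_element_iff_minpoly_natDegree_eq (ZMod 2) (u : K)).1 htop, hfr]
  have hIntg : IsIntegral (ZMod 2) (u : K) := IsIntegral.of_finite _ _
  have hmin : ∀ p : (ZMod 2)[X], p.natDegree < k → aeval (u : K) p = 0 → p = 0 := by
    intro p hp h0
    by_contra hne
    have := natDegree_le_natDegree (minpoly.degree_le_of_ne_zero (ZMod 2) (u : K) hne h0)
    omega
  have hsurj : ∀ b : K, ∃ p : (ZMod 2)[X], p.degree < k ∧ aeval (u : K) p = b := by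
    intro b
    have : ∃ p : (ZMod 2)[X], aeval (u : K) p = b := by
      by_cases hb : b = 0
      · exact ⟨0, by simp [hb]⟩
      · obtain ⟨j, _, rfl⟩ := hgen b hb
        exact ⟨X ^ j, by simp⟩
    obtain ⟨p, hp⟩ := this
    refine ⟨p %ₘ minpoly (ZMod 2) (u : K), ?_, ?_⟩
    · have := degree_modByMonic_lt p (minpoly.monic hIntg)
      rwa [degree_eq_natDegree (minpoly.monic hIntg).ne_zero, hdeg] at this
    · rw [aeval_modByMonic_eq_self_of_root (minpoly.aeval _ _), hp]
  let W : Submodule (ZMod 2) K := (degreeLT (ZMod 2) (k - 1)).map (aeval (u : K)).toLinearMap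
  have hW : ((u : K) - 1)⁻¹ ∉ W := by
    rintro ⟨p, hp, h⟩
    rw [SetLike.mem_coe, mem_degreeLT] at hp
    have h' : aeval (u : K) p = ((u : K) - 1)⁻¹ := h
    have hz : aeval (u : K) ((X - 1) * p - 1) = 0 := by
      simp [h', mul_inv_cancel₀ (sub_ne_zero.2 hne1)]
    have hp' : p.natDegree < k - 1 := by
      by_cases hp0 : p = 0
      · simp [hp0]; omega
      · exact (natDegree_lt_iff_degree_lt hp0).2 hp
    have hd : ((X - 1) * p - 1 : (ZMod 2)[X]).natDegree < k := by
      refine lt_of_le_of_lt (natDegree_sub_le _ _) ?_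
      rw [natDegree_one]
      have h1 := natDegree_mul_le (p := (X - 1 : (ZMod 2)[X])) (q := p)
      have h2 : (X - 1 : (ZMod 2)[X]).natDegree = 1 := by
        simpa using natDegree_X_sub_C (1 : ZMod 2)
      simp; omega
    have := congrArg (eval 1) (hmin _ hd hz)
    simp at this
  obtain ⟨l, hl, hlW⟩ := Submodule.exists_le_ker_of_notMem hW
  refine ⟨K, inferInstance, inferInstance, inferInstance, u, l, hcard, u.ne_zero, hne1, hoa, hgen, ?_, ?_, ?_⟩
  · intro j hj
    apply hlW
    refine ⟨X ^ j, ?_, by simp⟩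
    rw [SetLike.mem_coe, mem_degreeLT, degree_X_pow]
    exact_mod_cast hj
  · generalize l _ = z at hl
    revert z; decide
  · intro b hb
    by_contra hne
    apply hl
    obtain ⟨p, hp, h⟩ := hsurj (b⁻¹ * ((u : K) - 1)⁻¹)
    have : ((u : K) - 1)⁻¹ = b * aeval (u : K) p := by rw [h, mul_inv_cancel_left₀ hne]
    rw [this]
    by_cases hp0 : p = 0
    · simp [hp0]
    rw [aeval_eq_sum_range' ((natDegree_lt_iff_degree_lt hp0).2 hp), Finset.mul_sum, map_sum]
    refine Finset.sum_eq_zero fun i hi => ?_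
    rw [mul_smul_comm, map_smul, hb i (Finset.mem_range.1 hi), smul_zero]

lemma deBruijn (k : ℕ) (hk : 2 ≤ k) : ∃ s : ℕ → ZMod 2,
    PFam (2 ^ k) k Unit (fun _ => s) ∧ psum s (2 ^ k) = 0 ∧ psum (psum s) (2 ^ k) = 1 := by
  classical
  obtain ⟨K, _, _, _, a, l, hcard, ha0, ha1, hord, hgen, hl0, hl1, hnd⟩ := field_fact k hk
  have hkQ : k < 2 ^ k := Nat.lt_two_pow_self
  obtain ⟨N, hN⟩ : ∃ N, 2 ^ k = N + 1 := ⟨2 ^ k - 1, by omega⟩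
  have haN : a ^ N = 1 := by
    rw [← pow_orderOf_eq_one a, hord, hN]; rfl
  have hNodd : (N : ZMod 2) = 1 := by
    have h1 : ((2 ^ k : ℕ) : ZMod 2) = 0 := by
      push_cast
      rw [show (2 : ZMod 2) = 0 from by decide, zero_pow (by omega)]
    rw [hN] at h1
    push_cast at h1
    exact (z2 _ _).1 h1
  let v : ℕ → K := fun r => if r = 0 then 0 else a ^ (r - 1)
  let s : ℕ → ZMod 2 := fun i => l (v (i % 2 ^ k))
  have hwin : ∀ r < 2 ^ k, ∀ x < k, s (r + x) = l (v r * a ^ x) := by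
    intro r hr x hx
    simp only [s, v]
    rcases Nat.eq_zero_or_pos r with rfl | hr0
    · rw [zero_add, Nat.mod_eq_of_lt (by omega)]
      by_cases hx0 : x = 0
      · simp [hx0]
      · simp [hx0, hl0 (x - 1) (by omega)]
    · rw [if_neg (by omega : r ≠ 0), ← pow_add]
      rcases lt_or_ge (r + x) (2 ^ k) with h | h
      · rw [Nat.mod_eq_of_lt h, if_neg (by omega)]; congr 2; omega
      · rw [Nat.mod_eq_sub_mod h, Nat.mod_eq_of_lt (by omega)]
        have e : a ^ (r - 1 + x) = a ^ (r + x - 2 ^ k) := by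
          rw [show r - 1 + x = N + (r + x - 2 ^ k) by omega, pow_add, haN, one_mul]
        rw [e, hl0 (r + x - 2 ^ k) (by omega)]
        split_ifs
        · simp
        · exact hl0 _ (by omega)
  have hvsurj : ∀ b, ∃ r < 2 ^ k, v r = b := by
    intro b
    by_cases hb : b = 0
    · exact ⟨0, by omega, by simp [v, hb]⟩
    · obtain ⟨j, hj, h⟩ := hgen b hb
      exact ⟨j + 1, by omega, by simp [v, h]⟩
  have hvinj : ∀ r < 2 ^ k, ∀ r' < 2 ^ k, v r = v r' → r = r' := by
    intro r hr r' hr' h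
    simp only [v] at h
    split_ifs at h with h1 h2 h2
    · omega
    · exact absurd h.symm (pow_ne_zero _ ha0)
    · exact absurd h (pow_ne_zero _ ha0)
    · have := pow_injOn_Iio_orderOf (x := a) (show r - 1 ∈ Set.Iio (orderOf a) by
        rw [hord, Set.mem_Iio]; omega) (show r' - 1 ∈ Set.Iio (orderOf a) by
        rw [hord, Set.mem_Iio]; omega) h
      omega
  let Φ : K → (Fin k → ZMod 2) := fun b x => l (b * a ^ (x : ℕ))
  have hΦi : Function.Injective Φ := by
    intro b b' h
    rw [← sub_eq_zero]
    apply hnd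
    intro x hx
    have := congrFun h ⟨x, hx⟩
    simp only [Φ] at this
    rw [sub_mul, map_sub, this, sub_self]
  have hΦ : Function.Bijective Φ := by
    rw [Fintype.bijective_iff_injective_and_card]
    refine ⟨hΦi, ?_⟩
    simp [hcard, ZMod.card]
  have hps : ∀ i, i < 2 ^ k → psum s (i + 1) = l ((a ^ i - 1) * (a - 1)⁻¹) := by
    intro i
    induction i with
    | zero => simp [psum, s, v]
    | succ i ih =>
      intro hi
      rw [psum_succ, ih (by omega)]
      simp only [s, v]
      rw [Nat.mod_eq_of_lt hi, if_neg (by omega), ← map_add]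
      congr 1
      have := sub_ne_zero.2 ha1
      field_simp
      simp
      ring
  refine ⟨s, ⟨fun c i => by simp [s], fun w => ?_⟩, ?_, ?_⟩
  · obtain ⟨b, hb⟩ := hΦ.2 (fun x => w x)
    obtain ⟨r, hr, rfl⟩ := hvsurj b
    refine ⟨((), r), ⟨hr, fun x hx => ?_⟩, ?_⟩
    · dsimp only
      rw [hwin r hr x hx]; exact congrFun hb ⟨x, hx⟩
    · rintro ⟨_, r'⟩ ⟨hr', hc'⟩
      dsimp only at hr' hc'
      have : v r' = v r := by
        apply hΦi
        rw [hb]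
        funext x
        rw [← hc' x x.2, hwin r' hr' x x.2]
      rw [hvinj _ hr' _ hr this]
  · rw [hN, hps N (by omega), haN]; simp
  · rw [hN]
    have : psum (psum s) (N + 1) = ∑ i ∈ range N, psum s (i + 1) := by
      rw [psum, sum_range_succ']; simp [psum]
    rw [this, sum_congr rfl (fun i hi => hps i (by have := mem_range.1 hi; omega)), ← map_sum, ← sum_mul,
      sum_sub_distrib]
    have hg : ∑ i ∈ range N, a ^ i = 0 := by
      have := geom_sum_mul a N
      rw [haN, sub_self] at this
      exact (mul_eq_zero.1 this).resolve_right (sub_ne_zero.2 ha1)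
    rw [hg]
    have hc : ∑ i ∈ range N, (1 : K) = 1 := by
      have := congrArg (algebraMap (ZMod 2) K) hNodd
      simpa using this
    rw [hc, zero_sub, neg_one_mul, map_neg, hl1]; decide

lemma baseA (k : ℕ) (hk : 2 ≤ k) : ∃ (κ : Type) (_ : Fintype κ) (G : κ → ℕ → ZMod 2),
    PFam (2 * 2 ^ k) (k + 2) κ G ∧ ∀ c i, G c (i + 2 ^ k) = G c i + 1 := by
  obtain ⟨s, hs, h0, h1⟩ := deBruijn k hk
  have hl := lift_step hs (fun c i => by rw [psum_per (hs.per c), h0, add_zero])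
  have hd := double_step hl (fun c => by
    have : psum (fun i => c.2 + psum s i) (2 ^ k) = (2 ^ k : ℕ) * c.2 + psum (psum s) (2 ^ k) := by
      simp [psum, sum_add_distrib]
    rw [this, h1]
    push_cast
    rw [show (2 : ZMod 2) = 0 from by decide, zero_pow (by omega)]; simp)
  exact ⟨Unit × ZMod 2, inferInstance, _, hd.1, hd.2⟩

lemma exists_PFam (k n : ℕ) (hk : 1 ≤ k) (hkn : k < n) (hn : n < 2 ^ k) :
    ∃ (κ : Type) (_ : Fintype κ) (G : κ → ℕ → ZMod 2), PFam (2 ^ k) n κ G := by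
  obtain ⟨k, rfl⟩ := Nat.exists_eq_add_of_le' hk
  have e : 2 ^ (k + 1) = 2 * 2 ^ k := by ring
  rcases le_or_gt (2 ^ k) n with h | h
  · obtain ⟨κ, _, G, hG, ha⟩ := baseB k
    rw [← e] at hG
    have := lift_many (m := n - 2 ^ k) hG (fun a => kill_of_anti (ha a)) (by omega)
    rwa [Nat.add_sub_cancel' h] at this
  · have hk2 : 2 ≤ k := by
      rcases k with _ | _ | k <;> simp at * <;> omega
    obtain ⟨κ, _, G, hG, ha⟩ := baseA k hk2
    rw [← e] at hG
    have := lift_many (m := n - (k + 2)) hG (fun a => kill_of_anti (ha a)) (by omega)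
    rwa [Nat.add_sub_cancel' (by omega)] at this

lemma PFam_card {k n : ℕ} {κ : Type} [Fintype κ] {G : κ → ℕ → ZMod 2} (h : PFam (2 ^ k) n κ G) :
    Fintype.card κ * 2 ^ k = 2 ^ n := by
  classical
  have : Function.Bijective (fun p : κ × Fin (2 ^ k) => fun x : Fin n => G p.1 (p.2 + x)) := by
    rw [Function.bijective_iff_existsUnique]
    intro w
    obtain ⟨⟨c, i⟩, ⟨hi, hc⟩, hu⟩ := h.win (fun x => if hx : x < n then w ⟨x, hx⟩ else 0)
    refine ⟨(c, ⟨i, hi⟩), ?_, ?_⟩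
    · funext x
      have := hc x x.2
      simpa using this
    · rintro ⟨c', i'⟩ hc'
      have := hu (c', i') ⟨i'.2, fun x hx => by
        have := congrFun hc' ⟨x, hx⟩
        simpa [hx] using this⟩
      simp only [Prod.mk.injEq] at this
      ext1
      · exact this.1
      · exact Fin.ext this.2
  have := Fintype.card_of_bijective this
  simpa [ZMod.card] using this

theorem stmt_9 (k n t : ℕ) (hk : 1 ≤ k) (ht : 1 ≤ t) (htn : t ≤ n - k) :
    (∃ C : Fin (2 ^ (n - k - t)) → (ZMod (2 ^ k) × ZMod (2 ^ t) → ZMod 2),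
        IsDBAC (2 ^ k) (2 ^ t) n 1 (2 ^ (n - k - t)) C) ↔
      (k ≤ n ∧ n < 2 ^ k) := by
  have h2 : 2 ^ 1 ≤ 2 ^ k := Nat.pow_le_pow_right (by norm_num) hk
  have hne : NeZero (2 ^ k) := ⟨by positivity⟩
  have hnet : NeZero (2 ^ t) := ⟨by positivity⟩
  constructor
  · rintro ⟨C, hC⟩
    refine ⟨by omega, ?_⟩
    by_contra hcon
    obtain ⟨⟨c, i, j⟩, hp, hu⟩ := hC (fun _ _ => 0)
    dsimp only at hp
    have hz : ∀ r, C c (r, j) = 0 := by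
      intro r
      have hlt := ZMod.val_lt (r - i)
      have := hp ⟨(r - i).val, by omega⟩ 0
      simpa using this
    have := hu (c, i + 1, j) (fun x y => by
      have hy : y = 0 := Subsingleton.elim _ _
      subst hy
      simpa using hz _)
    simp only [Prod.mk.injEq, true_and, and_true] at this
    have : Fact (1 < 2 ^ k) := ⟨by omega⟩
    simp_all
  · rintro ⟨_, hn⟩
    obtain ⟨κ, _, G, hG⟩ := exists_PFam k n hk (by omega) hn
    have hcard := PFam_card hG
    have e : Fintype.card (Fin (2 ^ (n - k - t)) × ZMod (2 ^ t)) = Fintype.card κ := by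
      have h3 : 2 ^ n = 2 ^ (n - k - t) * 2 ^ t * 2 ^ k := by
        rw [← pow_add, ← pow_add]; congr 1; omega
      rw [h3] at hcard
      rw [Fintype.card_prod, Fintype.card_fin, ZMod.card]
      exact (Nat.eq_of_mul_eq_mul_right (by positivity) hcard).symm
    let E := Fintype.equivOfCardEq e
    refine ⟨fun c p => G (E (c, p.2)) p.1.val, fun M => ?_⟩
    have hval : ∀ c (i : ZMod (2 ^ k)) (x : ℕ), G c (i + (x : ZMod (2 ^ k))).val = G c (i.val + x) := by
      intro c i x
      rw [ZMod.val_add, ZMod.val_natCast, Nat.add_mod_mod]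
      conv_rhs => rw [← Nat.mod_add_div (i.val + x) (2 ^ k)]
      rw [per_mul (hG.per c)]
    obtain ⟨⟨c, i⟩, ⟨hi, hc⟩, hu⟩ := hG.win (fun x => if hx : x < n then M ⟨x, hx⟩ 0 else 0)
    dsimp only at hi hc
    refine ⟨((E.symm c).1, (i : ZMod (2 ^ k)), (E.symm c).2), ?_, ?_⟩
    · intro x y
      have hy : y = 0 := Subsingleton.elim _ _
      subst hy
      have := hc x x.2
      dsimp only
      rw [hval, ZMod.val_natCast, Nat.mod_eq_of_lt hi]
      simpa using this
    · rintro ⟨c', i', j'⟩ h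
      have := hu (E (c', j'), i'.val) ⟨ZMod.val_lt i', fun x hx => by
        have := h ⟨x, hx⟩ 0
        dsimp only at this
        rw [hval] at this
        simpa [hx] using this⟩
      simp only [Prod.mk.injEq] at this
      obtain ⟨rfl, rfl⟩ := this
      simp
end

section
/- Let k, n, t, m be integers with k, n ≥ 2 and 3 ≤ m < 2^t. Suppose there exists a (2^k, 2^t; n, m)-de Bruijn array code of size Δ in which every column of every codeword has even weight, and suppose there exists a span m half de Bruijn sequence. Then there exists a (2^k, 2^{m+t−1}; n + 1, m)-de Bruijn array code of size 2Δ. -/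
/-- The weight of the `j`-th column of a doubly-periodic array `A`. -/
noncomputable def colWeight {r s : ℕ} (A : ZMod r × ZMod s → ZMod 2) (j : ZMod s) : ℕ :=
  {i : ZMod r | A (i, j) = 1}.ncard

/-- A span `m` half de Bruijn sequence: a binary cyclic sequence of length `2^(m-1)`
such that each binary `m`-tuple appears exactly once, up to complementation. -/
def IsHalfDeBruijn (m : ℕ) (s : ZMod (2 ^ (m - 1)) → ZMod 2) : Prop :=
  ∀ x : Fin m → ZMod 2,
    ∃! p : ZMod (2 ^ (m - 1)) × ZMod 2,
      ∀ i : Fin m, s (p.1 + (i : ℕ)) = x i + p.2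

theorem exists_integral (r : ℕ) [NeZero r] (f : ZMod r → ZMod 2)
    (h : Even ({i : ZMod r | f i = 1}.ncard)) :
    ∃ P : ZMod r → ZMod 2, ∀ i, P (i + 1) = P i + f i := by
  classical
  have hsum : ∑ i : ZMod r, f i = 0 := by
    have h1 : ∀ i, f i = if f i = 1 then 1 else 0 := by
      intro i
      generalize f i = a
      revert a
      decide
    rw [Finset.sum_congr rfl (fun i _ => h1 i), Finset.sum_boole]
    rw [Set.ncard_eq_toFinset_card'] at h
    have h2 : (Finset.univ.filter (fun i => f i = 1)) = {i : ZMod r | f i = 1}.toFinset := by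
      ext; simp
    rw [h2]
    exact (ZMod.natCast_eq_zero_iff_even).2 h
  have hrange : ∑ x ∈ Finset.range r, f (x : ZMod r) = 0 := by
    rw [← hsum]
    refine Finset.sum_bij' (fun x _ => (x : ZMod r)) (fun i _ => i.val) ?_ ?_ ?_ ?_ ?_
    · simp
    · intro i _; simpa using ZMod.val_lt i
    · intro x hx; exact ZMod.val_cast_of_lt (by simpa using hx)
    · intro i _; simp
    · simp
  refine ⟨fun i => ∑ x ∈ Finset.range i.val, f (x : ZMod r), fun i => ?_⟩
  have hi := ZMod.val_lt i
  have hc : ((i.val + 1 : ℕ) : ZMod r) = i + 1 := by simp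
  have key : ∑ x ∈ Finset.range (i.val + 1), f (x : ZMod r)
      = ∑ x ∈ Finset.range i.val, f (x : ZMod r) + f i := by
    rw [Finset.sum_range_succ]; simp
  rw [← key]
  rcases Nat.lt_or_ge (i.val + 1) r with h1 | h1
  · have : (i + 1).val = i.val + 1 := by rw [← hc, ZMod.val_cast_of_lt h1]
    simp only [this]
  · have h2 : i.val + 1 = r := by omega
    have h3 : i + 1 = 0 := by rw [← hc, h2]; simp
    simp only [h3, h2, hrange, ZMod.val_zero, Finset.range_zero, Finset.sum_empty]

theorem exists_spread (L N m : ℕ) [NeZero L] [NeZero N] (hL : 2 ≤ L) (hm : m ≤ N)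
    (hcop : Nat.Coprime (L - 1) N) (s : ZMod L → ZMod 2) (z : ZMod L) (ε : ZMod 2)
    (hz : ∀ i < m, s (z + (i : ℕ)) = ε) :
    ∃ (u : ZMod (L * N) → ZMod 2) (φ : ZMod (L * N) → ZMod L),
      (∀ p, ∀ i < m, u (p + (i : ℕ)) = s (φ p + (i : ℕ))) ∧
      Function.Bijective (fun p : ZMod (L * N) => (φ p, (ZMod.cast p : ZMod N))) := by
  have hN : 0 < N := Nat.pos_of_ne_zero (NeZero.ne N)
  haveI : NeZero (L * N) := ⟨by positivity⟩
  obtain ⟨K, rfl⟩ : ∃ K, L = K + 1 := ⟨L - 1, by omega⟩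
  simp only [Nat.add_sub_cancel] at hcop
  have hK : 0 < K := by omega
  have hLN : (K + 1) * N = K * N + N := by ring
  have hKN : N ≤ K * N := Nat.le_mul_of_pos_left N hK
  have hcast0 : ((K : ZMod (K + 1)) + 1) = 0 := by
    have : ((K + 1 : ℕ) : ZMod (K + 1)) = 0 := ZMod.natCast_self _
    simpa using this
  set S : ℕ → ZMod 2 := fun x => s (z + 1 + (x : ℕ)) with hS
  have hS1 : ∀ x, x + 1 < m → S x = ε := by
    intro x hx
    rw [← hz (x + 1) hx]; simp only [hS]; congr 1; push_cast; ring
  have hS2 : ∀ x, x < m → S (K + x) = ε := by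
    intro x hx
    rw [← hz x hx]; simp only [hS]; congr 1; push_cast
    linear_combination hcast0
  set U : ℕ → ZMod 2 := fun p => if p < N then ε else S ((p - N) % K) with hU
  set Φ : ℕ → ZMod (K + 1) := fun p => if p < N then z else z + 1 + (((p - N) % K : ℕ)) with hΦ
  refine ⟨fun p => U p.val, fun p => Φ p.val, ?_, ?_⟩
  · intro p i hi
    have hp := ZMod.val_lt p
    have hv : (p + (i : ℕ)).val = (p.val + i) % ((K + 1) * N) := by
      conv_lhs => rw [← ZMod.natCast_zmod_val p]
      rw [← Nat.cast_add, ZMod.val_natCast]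
    simp only [hv]
    generalize p.val = q at hp
    by_cases hq : q < N
    · have h1 : Φ q = z := by simp [hΦ, hq]
      rw [h1, hz i hi, Nat.mod_eq_of_lt (by omega)]
      simp only [hU]
      split_ifs with h2
      · rfl
      · apply hS1
        have := Nat.mod_le (q + i - N) K
        omega
    · have h1 : s (Φ q + (i : ℕ)) = S ((q - N) % K + i) := by
        simp only [hΦ, hq, hS, if_false]; congr 1; push_cast; ring
      rw [h1]
      have hb : (q - N) % K < K := Nat.mod_lt _ hK
      have hdm := Nat.div_add_mod (q - N) K
      by_cases hw : q + i < (K + 1) * N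
      · rw [Nat.mod_eq_of_lt hw]
        have h2 : ¬ (q + i < N) := by omega
        simp only [hU, h2, if_false]
        have h3 : (q + i - N) % K = ((q - N) % K + i) % K := by
          rw [Nat.mod_add_mod]; congr 1; omega
        rw [h3]
        by_cases h4 : (q - N) % K + i < K
        · rw [Nat.mod_eq_of_lt h4]
        · obtain ⟨d, hd⟩ : ∃ d, (q - N) % K + i = K + d := ⟨_, (Nat.add_sub_of_le (not_lt.1 h4)).symm⟩
          rw [hd, hS2 d (by omega), Nat.add_mod_left]
          apply hS1
          have := Nat.mod_le d K
          omega
      · have h2 : (q + i) % ((K + 1) * N) = q + i - (K + 1) * N := by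
          rw [Nat.mod_eq_sub_mod (by omega), Nat.mod_eq_of_lt (by omega)]
        rw [h2]
        have h3 : q + i - (K + 1) * N < N := by omega
        simp only [hU, h3, if_true]
        have h5 : (q - N) / K < N := by
          rw [Nat.div_lt_iff_lt_mul hK, mul_comm]; omega
        have h6 : K * ((q - N) / K) + K ≤ K * N := by
          rw [← Nat.mul_succ]; exact Nat.mul_le_mul_left K h5
        obtain ⟨d, hd⟩ : ∃ d, (q - N) % K + i = K + d :=
          ⟨(q - N) % K + i - K, by omega⟩
        rw [hd, hS2 d (by omega)]
  · rw [Fintype.bijective_iff_injective_and_card]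
    constructor
    · intro p p' h
      simp only [Prod.mk.injEq] at h
      obtain ⟨h1, h2⟩ := h
      rw [ZMod.cast_eq_val, ZMod.cast_eq_val, ZMod.natCast_eq_natCast_iff] at h2
      apply ZMod.val_injective
      have hp := ZMod.val_lt p
      have hp' := ZMod.val_lt p'
      generalize p.val = q at *
      generalize p'.val = q' at *
      have hne : ∀ x, z ≠ z + 1 + ((x % K : ℕ) : ZMod (K + 1)) := by
        intro x hx
        have hb : x % K < K := Nat.mod_lt _ hK
        have h3 : ((x % K + 1 : ℕ) : ZMod (K + 1)) = 0 := by
          push_cast; linear_combination -hx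
        rw [ZMod.natCast_eq_zero_iff] at h3
        have := Nat.le_of_dvd (by omega) h3
        omega
      by_cases hq : q < N <;> by_cases hq' : q' < N <;>
        simp only [hΦ, hq, hq', if_true, if_false] at h1
      · exact Nat.ModEq.eq_of_lt_of_lt h2 hq hq'
      · exact absurd h1 (hne _)
      · exact absurd h1.symm (hne _)
      · have h3 := add_left_cancel h1
        have hb : (q - N) % K < K := Nat.mod_lt _ hK
        have hb' : (q' - N) % K < K := Nat.mod_lt _ hK
        rw [ZMod.natCast_eq_natCast_iff] at h3
        have h4 : (q - N) ≡ (q' - N) [MOD K] :=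
          Nat.ModEq.eq_of_lt_of_lt h3 (by omega) (by omega)
        have h5 : (q - N) ≡ (q' - N) [MOD N] := by
          apply Nat.ModEq.add_right_cancel' N
          rwa [Nat.sub_add_cancel (by omega), Nat.sub_add_cancel (by omega)]
        have h6 := (Nat.modEq_and_modEq_iff_modEq_mul hcop).1 ⟨h4, h5⟩
        have := Nat.ModEq.eq_of_lt_of_lt h6 (by omega) (by omega)
        omega
    · simp [ZMod.card]

theorem window_iff (n : ℕ) (W : ℕ → ZMod 2) (M : Fin (n + 1) → ZMod 2) :
    (∀ x : Fin (n + 1), W x = M x) ↔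
      W 0 = M 0 ∧ ∀ x : Fin n, W x + W (x + 1) = M x.castSucc + M x.succ := by
  constructor
  · intro h
    refine ⟨by simpa using h 0, fun x => ?_⟩
    rw [← h, ← h]; simp
  · rintro ⟨h0, h⟩ x
    induction x using Fin.induction with
    | zero => simpa using h0
    | succ x ih =>
      have := h x
      simp only [Fin.val_castSucc] at ih
      rw [ih] at this
      simpa using this

theorem stmt_14 (k n t m Δ : ℕ) (hk : 2 ≤ k) (hn : 2 ≤ n) (hm : 3 ≤ m) (hmt : m < 2 ^ t)
    (C : Fin Δ → (ZMod (2 ^ k) × ZMod (2 ^ t) → ZMod 2))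
    (hC : IsDBAC (2 ^ k) (2 ^ t) n m Δ C)
    (heven : ∀ c, ∀ j : ZMod (2 ^ t), Even (colWeight (C c) j))
    (hhalf : ∃ s : ZMod (2 ^ (m - 1)) → ZMod 2, IsHalfDeBruijn m s) :
    ∃ C' : Fin (2 * Δ) → (ZMod (2 ^ k) × ZMod (2 ^ (m + t - 1)) → ZMod 2),
      IsDBAC (2 ^ k) (2 ^ (m + t - 1)) (n + 1) m (2 * Δ) C' := by
  obtain ⟨s, hs⟩ := hhalf
  obtain ⟨⟨z, ε⟩, hz, -⟩ := hs 0
  have hR : 2 ^ (m + t - 1) = 2 ^ (m - 1) * 2 ^ t := by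
    rw [← pow_add]; congr 1; omega
  rw [hR]
  have hL4 : 2 ≤ 2 ^ (m - 1) := by
    calc 2 = 2 ^ 1 := rfl
      _ ≤ 2 ^ (m - 1) := Nat.pow_le_pow_right (by norm_num) (by omega)
  have hcop : Nat.Coprime (2 ^ (m - 1) - 1) (2 ^ t) := by
    apply Nat.Coprime.pow_right
    rw [Nat.coprime_two_right]
    exact Nat.Even.sub_odd (by omega) ((even_two).pow_of_ne_zero (by omega)) odd_one
  obtain ⟨u, φ, hu, hφ⟩ := exists_spread (2 ^ (m - 1)) (2 ^ t) m hL4 hmt.le hcop s z ε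
    (fun i hi => by simpa using hz ⟨i, hi⟩)
  have hP : ∀ c (j : ZMod (2 ^ t)), ∃ P : ZMod (2 ^ k) → ZMod 2,
      ∀ i, P (i + 1) = P i + C c (i, j) :=
    fun c j => exists_integral (2 ^ k) (fun i => C c (i, j)) (heven c j)
  choose P hP using hP
  let e : Fin (2 * Δ) ≃ ZMod 2 × Fin Δ := (finProdFinEquiv (m := 2) (n := Δ)).symm
  refine ⟨fun a q => u q.2 + (e a).1 + P (e a).2 (ZMod.cast q.2) q.1, fun M => ?_⟩
  have hcast : ∀ (p : ZMod (2 ^ (m - 1) * 2 ^ t)) (y : ℕ),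
      (ZMod.cast (p + ((y : ℕ) : ZMod (2 ^ (m - 1) * 2 ^ t))) : ZMod (2 ^ t)) = ZMod.cast p + (y : ℕ) := by
    intro p y
    rw [ZMod.cast_add (Dvd.intro_left _ rfl), ZMod.cast_natCast (Dvd.intro_left _ rfl)]
  have two : ∀ a : ZMod 2, a + a = 0 := by decide
  -- characterisation of windows
  have hchar : ∀ (a : Fin (2 * Δ)) (i : ZMod (2 ^ k)) (p : ZMod (2 ^ (m - 1) * 2 ^ t)),
      (∀ (x : Fin (n + 1)) (y : Fin m),
        u (p + (y : ℕ)) + (e a).1 + P (e a).2 (ZMod.cast (p + ((y : ℕ) : ZMod (2 ^ (m - 1) * 2 ^ t)))) (i + (x : ℕ)) = M x y) ↔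
      (∀ (x : Fin n) (y : Fin m), C (e a).2 (i + (x : ℕ), (ZMod.cast p : ZMod (2 ^ t)) + (y : ℕ))
          = M x.castSucc y + M x.succ y) ∧
      ∀ y : Fin m, s (φ p + (y : ℕ)) =
        (M 0 y + P (e a).2 ((ZMod.cast p : ZMod (2 ^ t)) + (y : ℕ)) i) + (e a).1 := by
    intro a i p
    rw [forall_comm]
    have hy : ∀ y : Fin m, (∀ x : Fin (n + 1),
        u (p + (y : ℕ)) + (e a).1 + P (e a).2 (ZMod.cast (p + ((y : ℕ) : ZMod (2 ^ (m - 1) * 2 ^ t)))) (i + (x : ℕ)) = M x y) ↔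
        (s (φ p + (y : ℕ)) =
          (M 0 y + P (e a).2 ((ZMod.cast p : ZMod (2 ^ t)) + (y : ℕ)) i) + (e a).1) ∧
        ∀ x : Fin n, C (e a).2 (i + (x : ℕ), (ZMod.cast p : ZMod (2 ^ t)) + (y : ℕ))
          = M x.castSucc y + M x.succ y := by
      intro y
      rw [hcast, hu p y y.2]
      rw [window_iff n (fun x => s (φ p + (y : ℕ)) + (e a).1 +
        P (e a).2 ((ZMod.cast p : ZMod (2 ^ t)) + (y : ℕ)) (i + (x : ℕ))) (fun x => M x y)]
      have h1 : ∀ a b c d : ZMod 2, a + b + c = d ↔ a = d + c + b := by decide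
      have h2 : ∀ a b c d : ZMod 2, a + b + c + (a + b + (c + d)) = d := by decide
      simp only [Nat.cast_zero, add_zero, h1 _ _ _ (M 0 y), Nat.cast_add, Nat.cast_one,
        ← add_assoc i, hP, h2]
    simp only [hy, forall_and]
    rw [and_comm, forall_comm]
  simp only [hchar]
  obtain ⟨⟨c, i, j⟩, hc, hcu⟩ := hC (fun x y => M x.castSucc y + M x.succ y)
  obtain ⟨⟨q, δ⟩, hq, hqu⟩ := hs (fun y => M 0 y + P c (j + (y : ℕ)) i)
  obtain ⟨p, hp⟩ := hφ.2 (q, j)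
  simp only [Prod.mk.injEq] at hp
  obtain ⟨hp1, hp2⟩ := hp
  refine ⟨(e.symm (δ, c), i, p), ?_, ?_⟩
  · simp only [Equiv.apply_symm_apply, hp1, hp2]
    exact ⟨hc, hq⟩
  · rintro ⟨a, i', p'⟩ ⟨h1, h2⟩
    have h3 := hcu ((e a).2, i', ZMod.cast p') h1
    simp only [Prod.mk.injEq] at h3
    obtain ⟨h3, h4, h5⟩ := h3
    simp only at h2
    rw [h3, h4, h5] at h2
    have h6 := hqu (φ p', (e a).1) h2
    simp only [Prod.mk.injEq] at h6
    have h7 : p' = p := hφ.1 (by simp only [h6.1, h5, hp1, hp2])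
    have h8 : a = e.symm (δ, c) := by
      rw [Equiv.eq_symm_apply]; exact Prod.ext h6.2 h3
    rw [h4, h7, h8]
end
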